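/- arXiv:2508.04602 — 2 statements merged into one kernel-verified Lean document; each statement's English description precedes it below -/
import Mathlib

section
/- Let P = P_1...P_n be a convex polygon and A a finite set of m points in its interior, with the configuration in general+ position. Let c_1, ..., c_n be positive integers with Σ c_i = m. Then there exist an index i ∈ {2, ..., n−1} and a point Q inside triangle P_1P_iP_{i+1} such that exactly c_1 + ... + c_{i−1} points of A lie inside polygon P_1P_2...P_iQ, exactly c_i points of A lie inside triangle P_iQP_{i+1}, and exactly c_{i+1} + ... + c_n points of A lie inside polygon P_1QP_{i+1}...P_n, and moreover the enlarged configuration remains in general+ position. -/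
noncomputable section
open Set

/-- A set of points is in general position if no three distinct points of it are
collinear. -/
def GenPos (S : Set (ℝ × ℝ)) : Prop :=
  ∀ p ∈ S, ∀ q ∈ S, ∀ r ∈ S, p ≠ q → p ≠ r → q ≠ r →
    ¬ Collinear ℝ ({p, q, r} : Set (ℝ × ℝ))

/-- The line through two (distinct) points, as a set of points. -/
def lineThrough (a b : ℝ × ℝ) : Set (ℝ × ℝ) :=
  {x | Collinear ℝ ({a, b, x} : Set (ℝ × ℝ))}
/-- `S` is in general⁺ position: general position and no three connecting lines through
six distinct points of `S` are concurrent. -/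
def GenPlusPos (S : Set (ℝ × ℝ)) : Prop :=
  GenPos S ∧
    ∀ a ∈ S, ∀ b ∈ S, ∀ c ∈ S, ∀ d ∈ S, ∀ e ∈ S, ∀ f ∈ S,
      ([a, b, c, d, e, f] : List (ℝ × ℝ)).Pairwise (· ≠ ·) →
      ¬ ∃ x, x ∈ lineThrough a b ∧ x ∈ lineThrough c d ∧ x ∈ lineThrough e f
open Set

/-- 2D cross product (orientation test) of `b - a` and `c - a`. -/
def cross2 (a b c : ℝ × ℝ) : ℝ :=
  (b.1 - a.1) * (c.2 - a.2) - (b.2 - a.2) * (c.1 - a.1)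

/-- `v` lists the vertices of a (strictly) convex polygon in counterclockwise order:
every vertex other than the endpoints of an edge lies strictly to the left of that
edge.  In particular no interior angle is flat. -/
def IsConvexPolygonCCW {n : ℕ} [NeZero n] (v : Fin n → ℝ × ℝ) : Prop :=
  3 ≤ n ∧ ∀ i j : Fin n, j ≠ i → j ≠ i + 1 → 0 < cross2 (v i) (v (i + 1)) (v j)
/-- Boundary of the closed polygon whose vertices are listed (in order) by `l`. -/
def polyBoundaryL (l : List (ℝ × ℝ)) : Set (ℝ × ℝ) :=
  {x | ∃ p ∈ l.zip (l.rotate 1), x ∈ segment ℝ p.1 p.2}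

/-- Open region strictly inside the polygon with vertex list `l`: points off the
boundary whose connected component in the boundary's complement is bounded. -/
def polyInteriorL (l : List (ℝ × ℝ)) : Set (ℝ × ℝ) :=
  {x | x ∉ polyBoundaryL l ∧
    Bornology.IsBounded (connectedComponentIn (polyBoundaryL l)ᶜ x)}

lemma collinear_iff_cross2_eq_zero (a b c : ℝ × ℝ) :
    Collinear ℝ ({a, b, c} : Set (ℝ × ℝ)) ↔ cross2 a b c = 0 := by
  constructor
  · intro h
    obtain ⟨w, hw⟩ := (collinear_iff_of_mem (p₀ := a) (by simp)).1 h
    obtain ⟨r, hr⟩ := hw b (by simp)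
    obtain ⟨s, hs⟩ := hw c (by simp)
    simp [cross2, hr, hs]
    ring
  · intro h
    by_cases hab : b = a
    · subst hab
      simpa using collinear_pair ℝ b c
    have hne : (b.1 - a.1) ^ 2 + (b.2 - a.2) ^ 2 ≠ 0 := by
      intro h0
      apply hab
      ext <;> nlinarith [sq_nonneg (b.1 - a.1), sq_nonneg (b.2 - a.2)]
    rw [collinear_iff_of_mem (p₀ := a) (by simp)]
    refine ⟨b - a, ?_⟩
    rintro p (rfl | rfl | rfl)
    · exact ⟨0, by simp⟩
    · exact ⟨1, by simp⟩
    · refine ⟨((b.1 - a.1) * (p.1 - a.1) + (b.2 - a.2) * (p.2 - a.2)) /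
        ((b.1 - a.1) ^ 2 + (b.2 - a.2) ^ 2), ?_⟩
      unfold cross2 at h
      ext
      · simp
        field_simp
        linear_combination (a.2 - b.2) * h
      · simp
        field_simp
        linear_combination (b.1 - a.1) * h

lemma mem_lineThrough_iff (a b x : ℝ × ℝ) : x ∈ lineThrough a b ↔ cross2 a b x = 0 :=
  collinear_iff_cross2_eq_zero a b x

lemma cross2_rotate (a b c : ℝ × ℝ) : cross2 a b c = cross2 b c a := by
  unfold cross2; ring

lemma cross2_swap (a b c : ℝ × ℝ) : cross2 a b c = -cross2 b a c := by
  unfold cross2; ring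

lemma cross2_swap_right (a b c : ℝ × ℝ) : cross2 a b c = -cross2 a c b := by
  unfold cross2; ring

lemma cross2_self_left (a c : ℝ × ℝ) : cross2 a a c = 0 := by
  unfold cross2; ring

lemma cross2_self_right (a c : ℝ × ℝ) : cross2 a c c = 0 := by
  unfold cross2; ring

lemma cross2_self_outer (a c : ℝ × ℝ) : cross2 a c a = 0 := by
  unfold cross2; ring

/-- The Plücker relation for the four directions from `o` to `e`, `a`, `b`, `y`. -/
lemma cross2_pluecker (o e a b y : ℝ × ℝ) :
    cross2 o e a * cross2 o b y - cross2 o e b * cross2 o a y + cross2 o e y * cross2 o a b =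
      0 := by
  unfold cross2; ring

lemma GenPos.cross2_ne_zero {S : Set (ℝ × ℝ)} (h : GenPos S) {p q r : ℝ × ℝ} (hp : p ∈ S)
    (hq : q ∈ S) (hr : r ∈ S) (hpq : p ≠ q) (hpr : p ≠ r) (hqr : q ≠ r) :
    cross2 p q r ≠ 0 := fun h0 =>
  h p hp q hq r hr hpq hpr hqr ((collinear_iff_cross2_eq_zero p q r).2 h0)

/-- Three points on a common line are collinear. -/
lemma cross2_eq_zero_of_mem_line {p q x y r : ℝ × ℝ} (hpq : p ≠ q) (h1 : cross2 p q x = 0)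
    (h2 : cross2 p q y = 0) (h3 : cross2 p q r = 0) : cross2 x y r = 0 := by
  have e1 : (q.1 - p.1) * cross2 x y r = 0 := by
    unfold cross2 at *
    linear_combination (r.1 - y.1) * h1 + (x.1 - r.1) * h2 + (y.1 - x.1) * h3
  have e2 : (q.2 - p.2) * cross2 x y r = 0 := by
    unfold cross2 at *
    linear_combination (r.2 - y.2) * h1 + (x.2 - r.2) * h2 + (y.2 - x.2) * h3
  rcases mul_eq_zero.1 e1 with e1 | e1
  · rcases mul_eq_zero.1 e2 with e2 | e2
    · exact absurd (Prod.ext (by linarith) (by linarith)) hpq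
    · exact e2
  · exact e1

lemma pairwise_ne_five {α : Type*} {b c d e f : α} :
    [b, c, d, e, f].Pairwise (· ≠ ·) ↔ (b ≠ c ∧ b ≠ d ∧ b ≠ e ∧ b ≠ f) ∧
      (c ≠ d ∧ c ≠ e ∧ c ≠ f) ∧ (d ≠ e ∧ d ≠ f) ∧ e ≠ f := by
  simp

lemma pairwise_ne_six {α : Type*} {a b c d e f : α} :
    [a, b, c, d, e, f].Pairwise (· ≠ ·) ↔ (a ≠ b ∧ a ≠ c ∧ a ≠ d ∧ a ≠ e ∧ a ≠ f) ∧
      (b ≠ c ∧ b ≠ d ∧ b ≠ e ∧ b ≠ f) ∧ (c ≠ d ∧ c ≠ e ∧ c ≠ f) ∧ (d ≠ e ∧ d ≠ f) ∧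
      e ≠ f := by
  simp

open MeasureTheory in
/-- Almost every point of the plane avoids a given line. -/
lemma ae_cross2_ne_zero {a b : ℝ × ℝ} (hab : a ≠ b) :
    ∀ᵐ q : ℝ × ℝ, cross2 a b q ≠ 0 := by
  have htop : line[ℝ, a, b] ≠ ⊤ := by
    intro h
    have hcol : ∀ c : ℝ × ℝ, cross2 a b c = 0 := by
      intro c
      have hc : c ∈ line[ℝ, a, b] := by rw [h]; trivial
      have := collinear_insert_of_mem_affineSpan_pair hc
      rwa [← cross2_rotate c a b, ← collinear_iff_cross2_eq_zero]
    apply hab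
    have h1 := hcol (a.1 + 1, a.2)
    have h2 := hcol (a.1, a.2 + 1)
    simp [cross2] at h1 h2
    ext <;> linarith
  have h0 := Measure.addHaar_affineSubspace (volume : Measure (ℝ × ℝ)) _ htop
  refine measure_mono_null ?_ h0
  intro q hq
  simp only [Set.mem_compl_iff, Set.mem_ofPred_eq, not_not] at hq
  rw [← collinear_iff_cross2_eq_zero] at hq
  exact hq.mem_affineSpan_of_mem_of_ne (by simp) (by simp) (by simp) hab

/-- If three connecting lines of a set in general position, one of them through a variable
point `q`, are concurrent, then `q` lies on one of finitely many fixed lines. -/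
lemma ae_not_concurrent {S : Set (ℝ × ℝ)} (hS : GenPos S) {b c d e f : ℝ × ℝ} (hb : b ∈ S)
    (hc : c ∈ S) (hd : d ∈ S) (he : e ∈ S)
    (hne : [b, c, d, e, f].Pairwise (· ≠ ·)) :
    ∀ᵐ q : ℝ × ℝ, ¬ ∃ x, cross2 q b x = 0 ∧ cross2 c d x = 0 ∧ cross2 e f x = 0 := by
  obtain ⟨⟨hbc, hbd, hbe, hbf⟩, ⟨hcd, hce, hcf⟩, ⟨hde, hdf⟩, hef⟩ := pairwise_ne_five.1 hne
  by_cases hx : ∃ x, cross2 c d x = 0 ∧ cross2 e f x = 0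
  · obtain ⟨x, hx1, hx2⟩ := hx
    have hbx : b ≠ x := by
      rintro rfl
      exact hS.cross2_ne_zero hc hd hb hcd hbc.symm hbd.symm hx1
    filter_upwards [ae_cross2_ne_zero hbx] with q hq
    rintro ⟨y, hy0, hy1, hy2⟩
    have hxy : y = x := by
      by_contra hyx
      have hx : ∀ p r s : ℝ × ℝ, p ≠ r → cross2 p r x = 0 → cross2 p r y = 0 →
          cross2 p r s = 0 → cross2 x y s = 0 := fun p r s => cross2_eq_zero_of_mem_line
      exact hS.cross2_ne_zero hc hd he hcd hce hde <| cross2_eq_zero_of_mem_line (Ne.symm hyx)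
        (hx c d c hcd hx1 hy1 (cross2_self_outer c d))
        (hx c d d hcd hx1 hy1 (cross2_self_right c d))
        (hx e f e hef hx2 hy2 (cross2_self_outer e f))
    subst hxy
    exact hq ((cross2_rotate q b y).symm.trans hy0)
  · filter_upwards with q
    rintro ⟨y, -, hy⟩
    exact hx ⟨y, hy⟩

/-- Adding almost any point to a finite set in general⁺ position preserves general⁺ position. -/
lemma GenPlusPos.ae_union_singleton {S : Set (ℝ × ℝ)} (hfin : S.Finite) (hS : GenPlusPos S) :
    ∀ᵐ q : ℝ × ℝ, GenPlusPos (S ∪ {q}) := by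
  have hcount : Countable S := hfin.countable
  have h1 : ∀ᵐ q : ℝ × ℝ, ∀ a : S, ∀ b : S, a ≠ b → cross2 (a : ℝ × ℝ) b q ≠ 0 := by
    simp only [MeasureTheory.ae_all_iff]
    exact fun a b hab => ae_cross2_ne_zero fun h => hab (Subtype.ext h)
  have h2 : ∀ᵐ q : ℝ × ℝ, ∀ b c d e f : S,
      [(b : ℝ × ℝ), ↑c, ↑d, ↑e, ↑f].Pairwise (· ≠ ·) →
      ¬ ∃ x, cross2 q b x = 0 ∧ cross2 (c : ℝ × ℝ) d x = 0 ∧ cross2 (e : ℝ × ℝ) f x = 0 := by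
    simp only [MeasureTheory.ae_all_iff]
    exact fun b c d e f hne => ae_not_concurrent hS.1 b.2 c.2 d.2 e.2 hne
  filter_upwards [h1, h2] with q hq1 hq2
  have hq1' : ∀ a ∈ S, ∀ b ∈ S, a ≠ b → cross2 a b q ≠ 0 := fun a ha b hb hab =>
    hq1 ⟨a, ha⟩ ⟨b, hb⟩ fun h => hab (congrArg Subtype.val h)
  have hq2' : ∀ b ∈ S, ∀ c ∈ S, ∀ d ∈ S, ∀ e ∈ S, ∀ f ∈ S, [b, c, d, e, f].Pairwise (· ≠ ·) →
      ∀ x, cross2 q b x = 0 → cross2 c d x = 0 → cross2 e f x = 0 → False :=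
    fun b hb c hc d hd e he f hf hne x hx1 hx2 hx3 =>
      hq2 ⟨b, hb⟩ ⟨c, hc⟩ ⟨d, hd⟩ ⟨e, he⟩ ⟨f, hf⟩ hne ⟨x, hx1, hx2, hx3⟩
  have hmem : ∀ a, a ∈ S ∪ {q} → a ≠ q → a ∈ S := fun a ha haq => by
    simpa [haq] using ha
  constructor
  · intro a ha b hb c hc hab hac hbc
    rw [collinear_iff_cross2_eq_zero]
    by_cases hcq : c = q
    · subst hcq
      exact hq1' a (hmem a ha hac) b (hmem b hb hbc) hab
    by_cases hbq : b = q
    · subst hbq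
      rw [cross2_rotate, cross2_rotate]
      exact hq1' c (hmem c hc hcq) a (hmem a ha hab) hac.symm
    by_cases haq : a = q
    · subst haq
      rw [cross2_rotate]
      exact hq1' b (hmem b hb hbq) c (hmem c hc hcq) hbc
    exact hS.1.cross2_ne_zero (hmem a ha haq) (hmem b hb hbq) (hmem c hc hcq) hab hac hbc
  · intro a ha b hb c hc d hd e he f hf hne
    obtain ⟨⟨hab, hac, had, hae, haf⟩, ⟨hbc, hbd, hbe, hbf⟩, ⟨hcd, hce, hcf⟩, ⟨hde, hdf⟩,
      hef⟩ := pairwise_ne_six.1 hne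
    simp only [mem_lineThrough_iff]
    rintro ⟨x, hx1, hx2, hx3⟩
    have hswap : ∀ p r : ℝ × ℝ, cross2 p r x = 0 → cross2 r p x = 0 := fun p r h => by
      rw [cross2_swap, h, neg_zero]
    by_cases haq : a = q
    · subst haq
      refine hq2' b (hmem b hb hab.symm) c (hmem c hc hac.symm) d (hmem d hd had.symm)
        e (hmem e he hae.symm) f (hmem f hf haf.symm)
        (pairwise_ne_five.2 ⟨⟨hbc, hbd, hbe, hbf⟩, ⟨hcd, hce, hcf⟩,
          ⟨hde, hdf⟩, hef⟩) x hx1 hx2 hx3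
    by_cases hbq : b = q
    · subst hbq
      refine hq2' a (hmem a ha haq) c (hmem c hc hbc.symm) d (hmem d hd hbd.symm)
        e (hmem e he hbe.symm) f (hmem f hf hbf.symm)
        (pairwise_ne_five.2 ⟨⟨hac, had, hae, haf⟩, ⟨hcd, hce, hcf⟩,
          ⟨hde, hdf⟩, hef⟩) x (hswap _ _ hx1) hx2 hx3
    by_cases hcq : c = q
    · subst hcq
      refine hq2' d (hmem d hd hcd.symm) a (hmem a ha haq) b (hmem b hb hbq)
        e (hmem e he hce.symm) f (hmem f hf hcf.symm)
        (pairwise_ne_five.2 ⟨⟨had.symm, hbd.symm, hde, hdf⟩, ⟨hab, hae, haf⟩,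
          ⟨hbe, hbf⟩, hef⟩) x hx2 hx1 hx3
    by_cases hdq : d = q
    · subst hdq
      refine hq2' c (hmem c hc hcq) a (hmem a ha haq) b (hmem b hb hbq)
        e (hmem e he hde.symm) f (hmem f hf hdf.symm)
        (pairwise_ne_five.2 ⟨⟨hac.symm, hbc.symm, hce, hcf⟩, ⟨hab, hae, haf⟩,
          ⟨hbe, hbf⟩, hef⟩) x (hswap _ _ hx2) hx1 hx3
    by_cases heq : e = q
    · subst heq
      refine hq2' f (hmem f hf hef.symm) a (hmem a ha haq) b (hmem b hb hbq)
        c (hmem c hc hcq) d (hmem d hd hdq)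
        (pairwise_ne_five.2 ⟨⟨haf.symm, hbf.symm, hcf.symm, hdf.symm⟩, ⟨hab, hac, had⟩,
          ⟨hbc, hbd⟩, hcd⟩) x hx3 hx1 hx2
    by_cases hfq : f = q
    · subst hfq
      refine hq2' e (hmem e he heq) a (hmem a ha haq) b (hmem b hb hbq)
        c (hmem c hc hcq) d (hmem d hd hdq)
        (pairwise_ne_five.2 ⟨⟨hae.symm, hbe.symm, hce.symm, hde.symm⟩, ⟨hab, hac, had⟩,
          ⟨hbc, hbd⟩, hcd⟩) x (hswap _ _ hx3) hx1 hx2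
    refine hS.2 a (hmem a ha haq) b (hmem b hb hbq) c (hmem c hc hcq) d (hmem d hd hdq)
      e (hmem e he heq) f (hmem f hf hfq) hne ?_
    simp only [mem_lineThrough_iff]
    exact ⟨x, hx1, hx2, hx3⟩

/-- A function to `Fin 3` with prescribed fibre sizes. -/
lemma exists_fiber_card_eq {ι : Type*} [Fintype ι] (a : Fin 3 → ℕ)
    (ha : ∑ i, a i = Fintype.card ι) :
    ∃ σ : ι → Fin 3, ∀ i, (Finset.univ.filter fun x => σ x = i).card = a i := by
  have hcard : Fintype.card ι = Fintype.card (Σ i : Fin 3, Fin (a i)) := by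
    simp [← ha]
  obtain ⟨e⟩ := Fintype.card_eq.1 hcard
  refine ⟨fun x => (e x).1, fun i => ?_⟩
  rw [← Fintype.card_subtype, ← Fintype.card_fin (a i)]
  refine Fintype.card_congr ((e.subtypeEquiv (q := fun y => y.1 = i) fun x => Iff.rfl).trans ?_)
  exact Equiv.sigmaSubtype i

/-- Changing an assignment of minimal total cost along a cyclic exchange does not decrease the
cost. -/
lemma exists_minimal_assignment {ι : Type*} [Fintype ι] [DecidableEq ι] (u : ι → Fin 3 → ℝ)
    (hu : ∀ x i, 0 < u x i) (a : Fin 3 → ℕ) (ha : ∑ i, a i = Fintype.card ι) :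
    ∃ σ : ι → Fin 3, (∀ i, (Finset.univ.filter fun x => σ x = i).card = a i) ∧
      ∀ (τ : Equiv.Perm ι) (s : Finset ι), (∀ x ∉ s, τ x = x) →
        ∏ x ∈ s, u x (σ x) ≤ ∏ x ∈ s, u x (σ (τ x)) := by
  obtain ⟨σ₀, hσ₀⟩ := exists_fiber_card_eq a ha
  obtain ⟨π, -, hπ⟩ := Finset.exists_min_image (Finset.univ : Finset (Equiv.Perm ι))
    (fun π => ∏ x, u x (σ₀ (π x))) Finset.univ_nonempty
  refine ⟨fun x => σ₀ (π x), fun i => ?_, fun τ s hs => ?_⟩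
  · rw [← hσ₀ i]
    exact Finset.card_equiv π (by simp)
  · have h := hπ (τ.trans π) (Finset.mem_univ _)
    simp only [Equiv.trans_apply] at h
    rw [← Finset.prod_mul_prod_compl s, ← Finset.prod_mul_prod_compl s
      (fun x => u x (σ₀ (π (τ x))))] at h
    have hc : ∏ x ∈ sᶜ, u x (σ₀ (π (τ x))) = ∏ x ∈ sᶜ, u x (σ₀ (π x)) :=
      Finset.prod_congr rfl fun x hx => by rw [hs x (Finset.mem_compl.1 hx)]
    rw [hc] at h
    exact le_of_mul_le_mul_right h (Finset.prod_pos fun x _ => hu _ _)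

/-- Discrete optimal transport to three sinks: for generic positive costs there is an assignment
with prescribed fibre sizes that is strictly supported by multiplicative weights. -/
lemma exists_assignment_weights {ι : Type*} [Fintype ι] [DecidableEq ι] (u : ι → Fin 3 → ℝ)
    (hu : ∀ x i, 0 < u x i)
    (h2 : ∀ x y i j, x ≠ y → i ≠ j → u x i * u y j ≠ u x j * u y i)
    (h3 : ∀ x y z, x ≠ y → x ≠ z → y ≠ z →
      u x 0 * u y 1 * u z 2 ≠ u x 1 * u y 2 * u z 0)
    (a : Fin 3 → ℕ) (ha : ∑ i, a i = Fintype.card ι) :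
    ∃ σ : ι → Fin 3, (∀ i, (Finset.univ.filter fun x => σ x = i).card = a i) ∧
      ∃ w : Fin 3 → ℝ, (∀ i, 0 < w i) ∧
        ∀ x j, j ≠ σ x → u x (σ x) * w j < u x j * w (σ x) := by
  obtain ⟨σ, hσ, hmin⟩ := exists_minimal_assignment u hu a ha
  have hex2 : ∀ x y i j, i ≠ j → σ x = i → σ y = j → u x i * u y j < u x j * u y i := by
    intro x y i j hij hx hy
    have hxy : x ≠ y := by rintro rfl; exact hij (hx.symm.trans hy)
    refine lt_of_le_of_ne ?_ (h2 x y i j hxy hij)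
    have h := hmin (Equiv.swap x y) {x, y} (fun z hz => by
      simp only [Finset.mem_insert, Finset.mem_singleton, not_or] at hz
      exact Equiv.swap_apply_of_ne_of_ne hz.1 hz.2)
    simpa [Finset.prod_pair hxy, hx, hy] using h
  have hcyc : ∀ x y z, x ≠ y → x ≠ z → y ≠ z →
      u x (σ x) * (u y (σ y) * u z (σ z)) ≤ u x (σ y) * (u y (σ z) * u z (σ x)) := by
    intro x y z hxy hxz hyz
    have h := hmin (Equiv.swap x y * Equiv.swap y z) {x, y, z} (fun t ht => by
      simp only [Finset.mem_insert, Finset.mem_singleton, not_or] at ht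
      rw [Equiv.Perm.mul_apply, Equiv.swap_apply_of_ne_of_ne ht.2.1 ht.2.2,
        Equiv.swap_apply_of_ne_of_ne ht.1 ht.2.1])
    rw [Finset.prod_insert (by simp [hxy, hxz]), Finset.prod_pair hyz,
      Finset.prod_insert (by simp [hxy, hxz]), Finset.prod_pair hyz] at h
    simpa [Equiv.Perm.mul_apply, Equiv.swap_apply_of_ne_of_ne hxy hxz,
      Equiv.swap_apply_of_ne_of_ne hxz.symm hyz.symm] using h
  have hdist : ∀ x y, σ x ≠ σ y → x ≠ y := fun x y h hxy => h (by rw [hxy])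
  have hex3 : ∀ x y z, σ x = 0 → σ y = 1 → σ z = 2 →
      u x 0 * u y 1 * u z 2 < u x 1 * u y 2 * u z 0 ∧
      u x 0 * u y 1 * u z 2 < u x 2 * u y 0 * u z 1 := by
    intro x y z hx hy hz
    have hxy : x ≠ y := hdist x y (by simp [hx, hy])
    have hxz : x ≠ z := hdist x z (by simp [hx, hz])
    have hyz : y ≠ z := hdist y z (by simp [hy, hz])
    constructor
    · refine lt_of_le_of_ne ?_ (h3 x y z hxy hxz hyz)
      have := hcyc x y z hxy hxz hyz
      rw [hx, hy, hz] at this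
      linarith
    · refine lt_of_le_of_ne ?_ ?_
      · have := hcyc x z y hxz hxy hyz.symm
        rw [hx, hy, hz] at this
        linarith
      · intro h
        exact h3 y z x hyz hxy.symm hxz.symm (by linarith)
  refine ⟨σ, hσ, ?_⟩
  classical
  let C : Fin 3 → Finset ι := fun i => Finset.univ.filter fun x => σ x = i
  have hC : ∀ i x, x ∈ C i ↔ σ x = i := by simp [C]
  obtain ⟨q, hq1, hq2⟩ := Order.exists_between_finsets
    ({0} ∪ (C 1).image (fun x => u x 1 / u x 0) ∪
      (C 2 ×ˢ C 1).image (fun z => u z.1 2 / u z.1 0 * (u z.2 1 / u z.2 2)))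
    ((C 0).image (fun x => u x 1 / u x 0) ∪
      (C 0 ×ˢ C 2).image (fun z => u z.1 2 / u z.1 0 * (u z.2 1 / u z.2 2))) (by
    intro s hs t ht
    simp only [Finset.mem_union, Finset.mem_singleton, Finset.mem_image, Finset.mem_product,
      Prod.exists, hC] at hs ht
    rcases ht with ⟨x, hx, rfl⟩ | ⟨x, z, ⟨hx, hz⟩, rfl⟩ <;>
    rcases hs with (rfl | ⟨y, hy, rfl⟩) | ⟨z', y, ⟨hz', hy⟩, rfl⟩
    · have := hu x 0; have := hu x 1; positivity
    · rw [div_lt_div_iff₀ (hu _ _) (hu _ _)]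
      linarith [hex2 x y 0 1 (by decide) hx hy]
    · rw [div_mul_div_comm, div_lt_div_iff₀ (mul_pos (hu _ _) (hu _ _)) (hu _ _)]
      linarith [(hex3 x y z' hx hy hz').1]
    · have := hu x 0; have := hu x 2; have := hu z 1; have := hu z 2; positivity
    · rw [div_mul_div_comm, div_lt_div_iff₀ (hu _ _) (mul_pos (hu _ _) (hu _ _))]
      linarith [(hex3 x y z hx hy hz).2]
    · refine mul_lt_mul'' ?_ ?_ (div_pos (hu _ _) (hu _ _)).le (div_pos (hu _ _) (hu _ _)).le
      · rw [div_lt_div_iff₀ (hu _ _) (hu _ _)]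
        linarith [hex2 x z' 0 2 (by decide) hx hz']
      · rw [div_lt_div_iff₀ (hu _ _) (hu _ _)]
        linarith [hex2 y z 1 2 (by decide) hy hz])
  have hq0 : 0 < q := hq1 0 (by simp)
  have hq10 : ∀ y, σ y = 1 → u y 1 / u y 0 < q := fun y hy => hq1 _ (by
    simp only [Finset.mem_union, Finset.mem_image, hC]
    exact Or.inl (Or.inr ⟨y, hy, rfl⟩))
  have hq21 : ∀ z y, σ z = 2 → σ y = 1 → u z 2 / u z 0 * (u y 1 / u y 2) < q :=
    fun z y hz hy => hq1 _ (by
      simp only [Finset.mem_union, Finset.mem_image, Finset.mem_product, Prod.exists, hC]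
      exact Or.inr ⟨z, y, ⟨hz, hy⟩, rfl⟩)
  have hq01 : ∀ x, σ x = 0 → q < u x 1 / u x 0 := fun y hy => hq2 _ (by
    simp only [Finset.mem_union, Finset.mem_image, hC]
    exact Or.inl ⟨y, hy, rfl⟩)
  have hq02 : ∀ x z, σ x = 0 → σ z = 2 → q < u x 2 / u x 0 * (u z 1 / u z 2) :=
    fun z y hz hy => hq2 _ (by
      simp only [Finset.mem_union, Finset.mem_image, Finset.mem_product, Prod.exists, hC]
      exact Or.inr ⟨z, y, ⟨hz, hy⟩, rfl⟩)
  obtain ⟨r, hr1, hr2⟩ := Order.exists_between_finsets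
    ({0} ∪ (C 2).image (fun x => u x 2 / u x 0) ∪ (C 2).image (fun x => q * (u x 2 / u x 1)))
    ((C 0).image (fun x => u x 2 / u x 0) ∪ (C 1).image (fun x => q * (u x 2 / u x 1))) (by
    intro s hs t ht
    simp only [Finset.mem_union, Finset.mem_singleton, Finset.mem_image, hC] at hs ht
    rcases ht with ⟨x, hx, rfl⟩ | ⟨y, hy, rfl⟩ <;>
    rcases hs with (rfl | ⟨z, hz, rfl⟩) | ⟨z, hz, rfl⟩
    · exact div_pos (hu _ _) (hu _ _)
    · rw [div_lt_div_iff₀ (hu _ _) (hu _ _)]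
      linarith [hex2 x z 0 2 (by decide) hx hz]
    · have h := hq02 x z hx hz
      rwa [← inv_div (u _ 2) (u _ 1), ← div_eq_mul_inv, lt_div_iff₀ (div_pos (hu _ _) (hu _ _))] at h
    · exact mul_pos hq0 (div_pos (hu _ _) (hu _ _))
    · have h := hq21 z y hz hy
      rwa [← inv_div (u _ 2) (u _ 1), ← div_eq_mul_inv, div_lt_iff₀ (div_pos (hu _ _) (hu _ _))] at h
    · refine mul_lt_mul_of_pos_left ?_ hq0
      rw [div_lt_div_iff₀ (hu _ _) (hu _ _)]
      linarith [hex2 y z 1 2 (by decide) hy hz])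
  have hr0 : 0 < r := hr1 0 (by simp)
  have hr20 : ∀ z, σ z = 2 → u z 2 / u z 0 < r := fun z hz => hr1 _ (by
    simp only [Finset.mem_union, Finset.mem_image, hC]
    exact Or.inl (Or.inr ⟨z, hz, rfl⟩))
  have hr21 : ∀ z, σ z = 2 → q * (u z 2 / u z 1) < r := fun z hz => hr1 _ (by
    simp only [Finset.mem_union, Finset.mem_image, hC]
    exact Or.inr ⟨z, hz, rfl⟩)
  have hr02 : ∀ x, σ x = 0 → r < u x 2 / u x 0 := fun z hz => hr2 _ (by
    simp only [Finset.mem_union, Finset.mem_image, hC]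
    exact Or.inl ⟨z, hz, rfl⟩)
  have hr12 : ∀ y, σ y = 1 → r < q * (u y 2 / u y 1) := fun z hz => hr2 _ (by
    simp only [Finset.mem_union, Finset.mem_image, hC]
    exact Or.inr ⟨z, hz, rfl⟩)
  refine ⟨![1, q, r], fun i => by fin_cases i <;> simp [hq0, hr0], fun x j hj => ?_⟩
  have hx0 := hu x 0
  have hx1 := hu x 1
  generalize hi : σ x = i at hj
  fin_cases i <;> fin_cases j <;> simp at hj hi ⊢
  · have := hq01 x hi
    rw [lt_div_iff₀ hx0] at this
    linarith
  · have := hr02 x hi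
    rw [lt_div_iff₀ hx0] at this
    linarith
  · have := hq10 x hi
    rw [div_lt_iff₀ hx0] at this
    linarith
  · have := hr12 x hi
    rw [← mul_div_assoc, lt_div_iff₀ hx1] at this
    linarith
  · have := hr20 x hi
    rw [div_lt_iff₀ hx0] at this
    linarith
  · have := hr21 x hi
    rw [← mul_div_assoc, div_lt_iff₀ hx1] at this
    linarith

lemma cross2_combo (a b x y : ℝ × ℝ) {s t : ℝ} (hst : s + t = 1) :
    cross2 a b (s • x + t • y) = s * cross2 a b x + t * cross2 a b y := by
  obtain rfl : s = 1 - t := by linarith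
  simp [cross2]
  ring

lemma continuous_cross2_right (a b : ℝ × ℝ) : Continuous fun x => cross2 a b x := by
  unfold cross2; fun_prop

lemma continuous_cross2_middle (a b : ℝ × ℝ) : Continuous fun x => cross2 a x b := by
  unfold cross2; fun_prop

lemma continuous_cross2_left (a b : ℝ × ℝ) : Continuous fun x => cross2 x a b := by
  unfold cross2; fun_prop

lemma convex_cross2_nonneg (a b : ℝ × ℝ) : Convex ℝ {x | 0 ≤ cross2 a b x} := by
  intro x hx y hy s t hs ht hst
  rw [Set.mem_ofPred_eq] at *
  rw [cross2_combo a b x y hst]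
  positivity

lemma convex_cross2_neg (a b : ℝ × ℝ) : Convex ℝ {x | cross2 a b x < 0} := by
  intro x hx y hy s t hs ht hst
  rw [Set.mem_ofPred_eq] at *
  rw [cross2_combo a b x y hst]
  rcases hs.eq_or_lt with rfl | hs'
  · obtain rfl : t = 1 := by linarith
    linarith
  · nlinarith [mul_pos_of_neg_of_neg hx (neg_lt_zero.2 hs'),
      mul_nonneg ht (neg_nonneg.2 hy.le)]

lemma cross2_add_normal (a b x : ℝ × ℝ) (t : ℝ) :
    cross2 a b (x + t • (b.2 - a.2, -(b.1 - a.1))) =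
      cross2 a b x - t * ((b.1 - a.1) ^ 2 + (b.2 - a.2) ^ 2) := by
  simp [cross2]
  ring

lemma normSq_pos_of_ne {a b : ℝ × ℝ} (hab : a ≠ b) :
    0 < (b.1 - a.1) ^ 2 + (b.2 - a.2) ^ 2 := by
  by_contra h
  apply hab
  ext <;> nlinarith [sq_nonneg (b.1 - a.1), sq_nonneg (b.2 - a.2)]

lemma cross2_pos_of_mem_interior {s : Set (ℝ × ℝ)} {a b x : ℝ × ℝ} (hab : a ≠ b)
    (hs : ∀ y ∈ s, 0 ≤ cross2 a b y) (hx : x ∈ interior (convexHull ℝ s)) :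
    0 < cross2 a b x := by
  have hsub : convexHull ℝ s ⊆ {y | 0 ≤ cross2 a b y} :=
    convexHull_min hs (convex_cross2_nonneg a b)
  have hcont : Continuous fun t : ℝ => x + t • ((b.2 - a.2, -(b.1 - a.1)) : ℝ × ℝ) := by
    fun_prop
  have hev : ∀ᶠ t : ℝ in nhdsWithin 0 (Set.Ioi 0),
      x + t • ((b.2 - a.2, -(b.1 - a.1)) : ℝ × ℝ) ∈ interior (convexHull ℝ s) := by
    refine nhdsWithin_le_nhds ((isOpen_interior.preimage hcont).mem_nhds ?_)
    rw [Set.mem_preimage, zero_smul, add_zero]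
    exact hx
  obtain ⟨t, ht, ht0⟩ := (hev.and self_mem_nhdsWithin).exists
  have h := hsub (interior_subset ht)
  rw [Set.mem_ofPred_eq, cross2_add_normal] at h
  have := mul_pos (Set.mem_Ioi.1 ht0) (normSq_pos_of_ne hab)
  linarith

lemma not_isBounded_cross2_neg {a b x : ℝ × ℝ} (hab : a ≠ b) (hx : cross2 a b x < 0) :
    ¬ Bornology.IsBounded {y | cross2 a b y < 0} := by
  intro hb
  obtain ⟨R, hR⟩ := hb.exists_norm_le
  have hnorm := normSq_pos_of_ne hab
  set d : ℝ × ℝ := (b.2 - a.2, -(b.1 - a.1)) with hd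
  have hd0 : 0 < ‖d‖ := by
    rw [norm_pos_iff]
    intro h0
    simp only [hd, Prod.mk_eq_zero, neg_eq_zero] at h0
    simp [h0.1, h0.2] at hnorm
  have hmem : ∀ t : ℝ, 0 ≤ t → ‖x + t • d‖ ≤ R := fun t ht => hR _ (by
    rw [Set.mem_ofPred_eq, cross2_add_normal]
    have := mul_nonneg ht hnorm.le
    linarith)
  have h0 := hmem 0 le_rfl
  rw [zero_smul, add_zero] at h0
  have hR0 : 0 ≤ R := (norm_nonneg x).trans h0
  have h1 := hmem ((2 * R + 1) / ‖d‖) (by positivity)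
  have h2 : ‖((2 * R + 1) / ‖d‖) • d‖ = 2 * R + 1 := by
    rw [norm_smul, Real.norm_eq_abs, abs_of_nonneg (by positivity), div_mul_cancel₀ _ hd0.ne']
  have h3 := norm_sub_norm_le (((2 * R + 1) / ‖d‖) • d) (-x)
  rw [norm_neg, sub_neg_eq_add, add_comm _ x] at h3
  linarith

lemma mem_convexHull_triangle {X Y Z x : ℝ × ℝ} (hD : 0 < cross2 X Y Z)
    (hz : 0 ≤ cross2 X Y x) (hx : 0 ≤ cross2 Y Z x) (hy : 0 ≤ cross2 Z X x) :
    x ∈ convexHull ℝ ({X, Y, Z} : Set (ℝ × ℝ)) := by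
  have hsum : cross2 Y Z x + cross2 Z X x + cross2 X Y x = cross2 X Y Z := by
    unfold cross2; ring
  have h := (convex_convexHull ℝ ({X, Y, Z} : Set (ℝ × ℝ))).sum_mem
    (t := Finset.univ) (w := ![cross2 Y Z x / cross2 X Y Z, cross2 Z X x / cross2 X Y Z,
      cross2 X Y x / cross2 X Y Z]) (z := ![X, Y, Z])
    (by intro i _; fin_cases i <;> simp <;> positivity)
    (by
      simp only [Fin.sum_univ_three, Matrix.cons_val]
      rw [← add_div, ← add_div, hsum, div_self hD.ne'])
    (by intro i _; refine subset_convexHull ℝ _ ?_; fin_cases i <;> simp)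
  convert h using 1
  simp only [Fin.sum_univ_three, Matrix.cons_val]
  ext
  · simp
    field_simp
    unfold cross2
    ring
  · simp
    field_simp
    unfold cross2
    ring

lemma mem_interior_triangle_iff {X Y Z x : ℝ × ℝ} (hD : 0 < cross2 X Y Z) :
    x ∈ interior (convexHull ℝ ({X, Y, Z} : Set (ℝ × ℝ))) ↔
      0 < cross2 X Y x ∧ 0 < cross2 Y Z x ∧ 0 < cross2 Z X x := by
  have hD2 : 0 < cross2 Y Z X := cross2_rotate X Y Z ▸ hD
  have hD3 : 0 < cross2 Z X Y := cross2_rotate Y Z X ▸ hD2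
  constructor
  · intro h
    refine ⟨cross2_pos_of_mem_interior ?_ ?_ h, cross2_pos_of_mem_interior ?_ ?_ h,
      cross2_pos_of_mem_interior ?_ ?_ h⟩
    · rintro rfl; simp [cross2_self_left] at hD
    · rintro y (rfl | rfl | rfl)
      exacts [(cross2_self_outer _ _).ge, (cross2_self_right _ _).ge, hD.le]
    · rintro rfl; simp [cross2_self_right] at hD
    · rintro y (rfl | rfl | rfl)
      exacts [hD2.le, (cross2_self_outer _ _).ge, (cross2_self_right _ _).ge]
    · rintro rfl; simp [cross2_self_outer] at hD
    · rintro y (rfl | rfl | rfl)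
      exacts [(cross2_self_right _ _).ge, hD3.le, (cross2_self_outer _ _).ge]
  · rintro ⟨h1, h2, h3⟩
    have hopen : IsOpen {y | 0 < cross2 X Y y ∧ 0 < cross2 Y Z y ∧ 0 < cross2 Z X y} :=
      (isOpen_lt continuous_const (continuous_cross2_right X Y)).inter
        ((isOpen_lt continuous_const (continuous_cross2_right Y Z)).inter
          (isOpen_lt continuous_const (continuous_cross2_right Z X)))
    exact interior_maximal
      (fun y hy => mem_convexHull_triangle hD hy.1.le hy.2.1.le hy.2.2.le) hopen ⟨h1, h2, h3⟩

lemma mem_segment_of_cross2 {e a b f y : ℝ × ℝ} (h0 : cross2 a b y = 0)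
    (he : 0 < cross2 e a b) (hf : 0 < cross2 a b f) (hey : 0 ≤ cross2 e a y)
    (hfy : 0 ≤ cross2 b f y) : y ∈ segment ℝ a b := by
  have hy1 : cross2 e a b * (y.1 - a.1) = cross2 e a y * (b.1 - a.1) := by
    unfold cross2 at *
    linear_combination (e.1 - a.1) * h0
  have hy2 : cross2 e a b * (y.2 - a.2) = cross2 e a y * (b.2 - a.2) := by
    unfold cross2 at *
    linear_combination (e.2 - a.2) * h0
  have hle : cross2 e a y ≤ cross2 e a b := by
    have : cross2 e a b * cross2 b f y = (cross2 e a b - cross2 e a y) * cross2 a b f := by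
      unfold cross2 at *
      linear_combination (b.2 - f.2) * hy1 + (f.1 - b.1) * hy2
    have h := mul_nonneg he.le hfy
    rw [this] at h
    linarith [nonneg_of_mul_nonneg_left h hf]
  refine ⟨1 - cross2 e a y / cross2 e a b, cross2 e a y / cross2 e a b, ?_, by positivity,
    by ring, ?_⟩
  · rw [sub_nonneg, div_le_one he]
    exact hle
  · ext
    · simp
      field_simp
      linarith
    · simp
      field_simp
      linarith

/-- The closed polygonal path `p 0, …, p N = p 0` is a strictly convex polygon, listed
counterclockwise. -/
structure IsCCWCycle (N : ℕ) (p : ℕ → ℝ × ℝ) : Prop where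
  three_le : 3 ≤ N
  closed : p N = p 0
  pos : ∀ i < N, ∀ k < N, k ≠ i → k ≠ i + 1 → (i + 1 = N → k ≠ 0) →
    0 < cross2 (p i) (p (i + 1)) (p k)

namespace IsCCWCycle

variable {N : ℕ} {p : ℕ → ℝ × ℝ}

lemma nonneg (h : IsCCWCycle N p) {i k : ℕ} (hi : i < N) (hk : k ≤ N) :
    0 ≤ cross2 (p i) (p (i + 1)) (p k) := by
  have key : ∀ k < N, 0 ≤ cross2 (p i) (p (i + 1)) (p k) := by
    intro k hk
    by_cases h1 : k = i
    · rw [h1, cross2_self_outer]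
    by_cases h2 : k = i + 1
    · rw [h2, cross2_self_right]
    by_cases h3 : i + 1 = N ∧ k = 0
    · rw [h3.1, h3.2, h.closed, cross2_self_right]
    exact (h.pos i hi k hk h1 h2 fun h4 h5 => h3 ⟨h4, h5⟩).le
  rcases hk.lt_or_eq with hk | rfl
  · exact key k hk
  · rw [h.closed]
    exact key 0 (by have := h.three_le; omega)

lemma fan_pos (h : IsCCWCycle N p) {a b : ℕ} (ha : 0 < a) (hab : a < b) (hb : b < N) :
    0 < cross2 (p 0) (p a) (p b) := by
  have hstep : ∀ k, 0 < k → k + 1 < N → 0 < cross2 (p 0) (p k) (p (k + 1)) := by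
    intro k hk hk'
    rw [cross2_rotate]
    exact h.pos k (by omega) 0 (by omega) (by omega) (by omega) (by omega)
  induction b, hab using Nat.le_induction with
  | base => exact hstep a ha hb
  | succ b hab ih =>
    by_cases ha1 : a = 1
    · subst ha1
      exact h.pos 0 (by omega) (b + 1) hb (by omega) (by omega) (by omega)
    · have h1 := ih (by omega)
      have h2 := hstep b (by omega) hb
      have h3 := h.pos 0 (by omega) a (by omega) (by omega) (by omega) (by omega)
      have h4 := h.pos 0 (by omega) b (by omega) (by omega) (by omega) (by omega)
      have h5 := h.pos 0 (by omega) (b + 1) (by omega) (by omega) (by omega) (by omega)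
      have h6 := cross2_pluecker (p 0) (p (0 + 1)) (p a) (p b) (p (b + 1))
      have h7 := mul_pos h3 h2
      have h8 := mul_pos h5 h1
      by_contra hneg
      nlinarith [mul_nonneg h4.le (sub_nonneg.2 (not_lt.1 hneg))]

lemma ne_succ (h : IsCCWCycle N p) {i : ℕ} (hi : i < N) : p i ≠ p (i + 1) := by
  have h3 := h.three_le
  have hex : ∃ k < N, k ≠ i ∧ k ≠ i + 1 ∧ (i + 1 = N → k ≠ 0) := by
    by_cases h1 : 2 ≤ i
    · exact ⟨1, by omega, by omega, by omega, by omega⟩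
    · exact ⟨if i = 0 then 2 else 0, by split_ifs <;> omega, by split_ifs <;> omega,
        by split_ifs <;> omega, by split_ifs <;> omega⟩
  obtain ⟨k, hk, hk1, hk2, hk3⟩ := hex
  intro heq
  have := h.pos i hi k hk hk1 hk2 hk3
  rw [← heq, cross2_self_left] at this
  exact lt_irrefl _ this

lemma mem_segment (h : IsCCWCycle N p) {i : ℕ} (hi : i < N) {y : ℝ × ℝ}
    (hy : ∀ k < N, 0 ≤ cross2 (p k) (p (k + 1)) y) (h0 : cross2 (p i) (p (i + 1)) y = 0) :
    y ∈ segment ℝ (p i) (p (i + 1)) := by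
  have h3 := h.three_le
  obtain ⟨e, he, hei, hepos⟩ : ∃ e < N, p (e + 1) = p i ∧
      0 < cross2 (p e) (p (e + 1)) (p (i + 1)) := by
    by_cases hi0 : i = 0
    · subst hi0
      have : N - 1 + 1 = N := by omega
      exact ⟨N - 1, by omega, by rw [this, h.closed],
        h.pos _ (by omega) _ (by omega) (by omega) (by omega) (by omega)⟩
    · have h1 : i - 1 + 1 = i := by omega
      refine ⟨i - 1, by omega, by rw [h1], ?_⟩
      by_cases hiN : i + 1 = N
      · rw [hiN, h.closed]
        exact h.pos _ (by omega) _ (by omega) (by omega) (by omega) (by omega)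
      · exact h.pos _ (by omega) _ (by omega) (by omega) (by omega) (by omega)
  obtain ⟨f, hf, hfi, hfpos⟩ : ∃ f < N, p f = p (i + 1) ∧
      0 < cross2 (p i) (p (i + 1)) (p (f + 1)) := by
    by_cases hiN : i + 1 = N
    · refine ⟨0, by omega, by rw [hiN, h.closed], ?_⟩
      exact h.pos _ hi _ (by omega) (by omega) (by omega) (by omega)
    · refine ⟨i + 1, by omega, rfl, ?_⟩
      by_cases hiN' : i + 1 + 1 = N
      · rw [hiN', h.closed]
        exact h.pos _ (by omega) _ (by omega) (by omega) (by omega) (by omega)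
      · exact h.pos _ (by omega) _ (by omega) (by omega) (by omega) (by omega)
  have hey := hy e he
  have hfy := hy f hf
  rw [hei] at hepos hey
  rw [hfi] at hfy
  exact mem_segment_of_cross2 h0 hepos hfpos hey hfy

lemma isBounded (h : IsCCWCycle N p) :
    Bornology.IsBounded {x | ∀ i < N, 0 < cross2 (p i) (p (i + 1)) x} := by
  have h3 := h.three_le
  refine (isBounded_convexHull.2 ((Set.finite_Iio N).image p).isBounded).subset ?_
  intro x hx
  have hlast : cross2 (p 0) (p (N - 2 + 1)) x ≤ 0 := by
    have h1 := hx (N - 1) (by omega)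
    have e1 : N - 1 + 1 = N := by omega
    have e2 : N - 2 + 1 = N - 1 := by omega
    rw [e1, h.closed, cross2_swap] at h1
    rw [e2]
    linarith
  classical
  have hex : ∃ k, cross2 (p 0) (p (k + 1)) x ≤ 0 := ⟨_, hlast⟩
  obtain ⟨k, hk, hkmin⟩ : ∃ k, cross2 (p 0) (p (k + 1)) x ≤ 0 ∧
      ∀ l < k, ¬ cross2 (p 0) (p (l + 1)) x ≤ 0 :=
    ⟨Nat.find hex, Nat.find_spec hex, fun l hl => Nat.find_min hex hl⟩
  have hkN : k ≤ N - 2 := not_lt.1 fun hlt => hkmin _ hlt hlast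
  have hk0 : 0 < k := by
    rcases Nat.eq_zero_or_pos k with rfl | hk0
    · exact absurd hk (not_le.2 (hx 0 (by omega)))
    · exact hk0
  have hprev := hkmin (k - 1) (by omega)
  rw [Nat.sub_add_cancel hk0, not_le] at hprev
  refine convexHull_mono ?_ (mem_convexHull_triangle
    (h.fan_pos hk0 (Nat.lt_succ_self k) (by omega)) hprev.le (hx k (by omega)).le (by
      rw [cross2_swap]
      linarith))
  rintro y (rfl | rfl | rfl)
  exacts [⟨0, by simp; omega, rfl⟩, ⟨k, by simp; omega, rfl⟩, ⟨k + 1, by simp; omega, rfl⟩]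

lemma mem_polyBoundaryL_iff (hp : p N = p 0) {l : List (ℝ × ℝ)} (hlen : l.length = N)
    (hl : ∀ i (hi : i < l.length), l[i] = p i) (x : ℝ × ℝ) :
    x ∈ polyBoundaryL l ↔ ∃ i < N, x ∈ segment ℝ (p i) (p (i + 1)) := by
  have hzip : ∀ i (hi : i < (l.zip (l.rotate 1)).length),
      (l.zip (l.rotate 1))[i] = (p i, p (i + 1)) := by
    intro i hi
    have hi' : i < N := by simpa [hlen] using hi
    rw [List.getElem_zip, List.getElem_rotate, hl, hl, hlen]
    by_cases h : i + 1 = N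
    · rw [h, Nat.mod_self, hp]
    · rw [Nat.mod_eq_of_lt (by omega)]
  unfold polyBoundaryL
  rw [Set.mem_ofPred_eq]
  constructor
  · rintro ⟨q, hq, hx⟩
    obtain ⟨i, hi, rfl⟩ := List.mem_iff_getElem.1 hq
    rw [hzip] at hx
    exact ⟨i, by simpa [hlen] using hi, hx⟩
  · rintro ⟨i, hi, hx⟩
    have hi' : i < (l.zip (l.rotate 1)).length := by simpa [hlen] using hi
    exact ⟨_, List.getElem_mem hi', by rw [hzip]; exact hx⟩

/-- The interior of a convex polygon consists of the points strictly to the left of all edges. -/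
lemma polyInteriorL_eq (h : IsCCWCycle N p) {l : List (ℝ × ℝ)} (hlen : l.length = N)
    (hl : ∀ i (hi : i < l.length), l[i] = p i) :
    polyInteriorL l = {x | ∀ i < N, 0 < cross2 (p i) (p (i + 1)) x} := by
  have hB := mem_polyBoundaryL_iff h.closed hlen hl
  have hBnonneg : ∀ x ∈ polyBoundaryL l, ∀ i < N, 0 ≤ cross2 (p i) (p (i + 1)) x := by
    intro x hx i hi
    obtain ⟨k, hk, hxk⟩ := (hB x).1 hx
    exact (convex_cross2_nonneg _ _).segment_subset (h.nonneg hi hk.le)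
      (h.nonneg hi (Nat.succ_le_of_lt hk)) hxk
  ext x
  constructor
  · rintro ⟨hxB, hbdd⟩ i hi
    by_contra hneg
    by_cases hlt : ∃ k < N, cross2 (p k) (p (k + 1)) x < 0
    · obtain ⟨k, hk, hxk⟩ := hlt
      refine not_isBounded_cross2_neg (h.ne_succ hk) hxk (hbdd.subset ?_)
      refine (convex_cross2_neg _ _).isPreconnected.subset_connectedComponentIn hxk ?_
      intro y hy hyB
      exact absurd (hBnonneg y hyB k hk) (not_le.2 hy)
    · push Not at hlt
      exact hxB ((hB x).2 ⟨i, hi, h.mem_segment hi hlt (le_antisymm (not_lt.1 hneg) (hlt i hi))⟩)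
  · intro hx
    have hxB : x ∉ polyBoundaryL l := by
      intro hxB
      obtain ⟨k, hk, hxk⟩ := (hB x).1 hxB
      have := hx k hk
      obtain ⟨s, t, -, -, hst, rfl⟩ := hxk
      rw [cross2_combo _ _ _ _ hst, cross2_self_outer, cross2_self_right] at this
      simp at this
    refine ⟨hxB, h.isBounded.subset ?_⟩
    have hopen : IsOpen {x | ∀ i < N, 0 < cross2 (p i) (p (i + 1)) x} := by
      have : {x | ∀ i < N, 0 < cross2 (p i) (p (i + 1)) x} =
          ⋂ i ∈ Set.Iio N, {x | 0 < cross2 (p i) (p (i + 1)) x} := by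
        ext; simp
      rw [this]
      exact (Set.finite_Iio N).isOpen_biInter fun i _ =>
        isOpen_lt continuous_const (continuous_cross2_right _ _)
    have hclosed : IsClosed {x | ∀ i < N, 0 ≤ cross2 (p i) (p (i + 1)) x} := by
      simp only [Set.ofPred_forall]
      exact isClosed_iInter fun i => isClosed_iInter fun _ =>
        isClosed_le continuous_const (continuous_cross2_right _ _)
    refine isPreconnected_connectedComponentIn.subset_of_closure_inter_subset hopen
      ⟨x, mem_connectedComponentIn hxB, hx⟩ ?_
    rintro y ⟨hy1, hy2⟩ i hi
    have hyge : ∀ i < N, 0 ≤ cross2 (p i) (p (i + 1)) y :=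
      closure_minimal (fun z hz i hi => (hz i hi).le) hclosed hy1
    refine lt_of_le_of_ne (hyge i hi) fun h0 => ?_
    exact connectedComponentIn_subset _ _ hy2 ((hB y).2 ⟨i, hi, h.mem_segment hi hyge h0.symm⟩)

end IsCCWCycle

/-- A triangle containing finitely many points in general⁺ position can be split from a
point `Q` into three triangles with prescribed numbers of points; `Q` may be chosen freely in
a nonempty open set. -/
lemma exists_open_triangle_partition {S : Set (ℝ × ℝ)} (hS : GenPlusPos S)
    (V : Fin 3 → ℝ × ℝ) (hV : ∀ i, V i ∈ S) (hD : 0 < cross2 (V 0) (V 1) (V 2))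
    (T : Finset (ℝ × ℝ)) (hTS : ∀ x ∈ T, x ∈ S)
    (hT : ∀ x ∈ T, ∀ i, 0 < cross2 (V (i + 1)) (V (i + 2)) x)
    (a : Fin 3 → ℕ) (ha : ∑ i, a i = T.card) :
    ∃ O : Set (ℝ × ℝ), IsOpen O ∧ O.Nonempty ∧ ∀ Q ∈ O,
      (∀ i, 0 < cross2 (V (i + 1)) (V (i + 2)) Q) ∧
      ∀ i, (T.filter fun x => 0 < cross2 (V (i + 2)) Q x ∧
        0 < cross2 Q (V (i + 1)) x).card = a i := by
  classical
  have hVT : ∀ i, ∀ x ∈ T, V i ≠ x := by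
    intro i x hx h
    have h1 := hT x hx (i + 1)
    rw [← h] at h1
    fin_cases i <;> simp [cross2_self_right] at h1
  have hV01 : V 0 ≠ V 1 := fun h => by simp [h, cross2_self_left] at hD
  have hV12 : V 1 ≠ V 2 := fun h => by simp [h, cross2_self_right] at hD
  have hV02 : V 0 ≠ V 2 := fun h => by simp [h, cross2_self_outer] at hD
  have hcr : ∀ i, ∀ x ∈ T, ∀ y ∈ T, x ≠ y → cross2 (V i) x y ≠ 0 := fun i x hx y hy hxy =>
    hS.1.cross2_ne_zero (hV i) (hTS x hx) (hTS y hy) (hVT i x hx) (hVT i y hy) hxy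
  obtain ⟨σ, hσ, w, hw, hopt⟩ := exists_assignment_weights
    (fun (x : T) i => cross2 (V (i + 1)) (V (i + 2)) x) (fun x i => hT x x.2 i)
    (by
      rintro ⟨x, hx⟩ ⟨y, hy⟩ i j hxy hij heq
      have hxy' : x ≠ y := fun h => hxy (Subtype.ext h)
      have e0 := hcr 0 x hx y hy hxy'
      have e1 := hcr 1 x hx y hy hxy'
      have e2 := hcr 2 x hx y hy hxy'
      have key : ∀ X Y Z : ℝ × ℝ, cross2 X Y Z * cross2 Z x y =
          cross2 Y Z x * cross2 Z X y - cross2 Z X x * cross2 Y Z y := by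
        intro X Y Z; unfold cross2; ring
      have k2 := key (V 0) (V 1) (V 2)
      have k0 := key (V 1) (V 2) (V 0)
      have k1 := key (V 2) (V 0) (V 1)
      rw [← cross2_rotate] at k0
      rw [cross2_rotate] at k1
      have m0 := mul_ne_zero hD.ne' e0
      have m1 := mul_ne_zero hD.ne' e1
      have m2 := mul_ne_zero hD.ne' e2
      fin_cases i <;> fin_cases j <;> simp at hij heq
      · exact m2 (by linarith)
      · exact m1 (by linarith)
      · exact m2 (by linarith)
      · exact m0 (by linarith)
      · exact m1 (by linarith)
      · exact m0 (by linarith))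
    (by
      rintro ⟨x, hx⟩ ⟨y, hy⟩ ⟨z, hz⟩ hxy hxz hyz heq
      have hxy' : x ≠ y := fun h => hxy (Subtype.ext h)
      have hxz' : x ≠ z := fun h => hxz (Subtype.ext h)
      have hyz' : y ≠ z := fun h => hyz (Subtype.ext h)
      refine hS.2 (V 2) (hV 2) x (hTS x hx) (V 0) (hV 0) y (hTS y hy) (V 1) (hV 1) z
        (hTS z hz) (pairwise_ne_six.2 ⟨⟨hVT 2 x hx, hV02.symm, hVT 2 y hy, hV12.symm,
          hVT 2 z hz⟩, ⟨(hVT 0 x hx).symm, hxy', (hVT 1 x hx).symm, hxz'⟩,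
          ⟨hVT 0 y hy, hV01, hVT 0 z hz⟩, ⟨(hVT 1 y hy).symm, hyz'⟩, hVT 1 z hz⟩) ?_
      have hx0 := hT x hx 0
      have hx1 := hT x hx 1
      have hy1 := hT y hy 1
      have hy2 := hT y hy 2
      have hz0 := hT z hz 0
      have hz2 := hT z hz 2
      simp at hx0 hx1 hy1 hy2 hz0 hz2 heq
      have e1 : ∀ A : ℝ × ℝ, ∀ s t r : ℝ, s + t + r ≠ 0 → ∀ B,
          cross2 A B ((s + t + r)⁻¹ • (s • V 0 + t • V 1 + r • V 2)) = (s + t + r)⁻¹ *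
            (s * cross2 A B (V 0) + t * cross2 A B (V 1) + r * cross2 A B (V 2)) := by
        intro A s t r hne B
        simp [cross2]
        field_simp
        ring
      set s := cross2 (V 1) (V 2) x * cross2 (V 2) (V 0) y with hs
      set t := cross2 (V 2) (V 0) x * cross2 (V 2) (V 0) y with ht
      set r := cross2 (V 2) (V 0) x * cross2 (V 0) (V 1) y with hr
      have hsum : s + t + r ≠ 0 := by positivity
      refine ⟨(s + t + r)⁻¹ • (s • V 0 + t • V 1 + r • V 2), ?_, ?_, ?_⟩
      · rw [mem_lineThrough_iff, e1 _ _ _ _ hsum, mul_eq_zero]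
        right
        rw [cross2_self_outer, cross2_swap_right, cross2_swap_right (V 2) x (V 1),
          cross2_swap (V 2) (V 1), hs, ht]
        ring
      · rw [mem_lineThrough_iff, e1 _ _ _ _ hsum, mul_eq_zero]
        right
        rw [cross2_self_outer, cross2_swap_right, cross2_swap_right (V 0) y (V 2),
          cross2_swap (V 0) (V 2), hr, ht]
        ring
      · rw [mem_lineThrough_iff, e1 _ _ _ _ hsum, mul_eq_zero]
        right
        rw [cross2_self_outer, cross2_swap_right, cross2_swap_right (V 1) z (V 2),
          cross2_swap (V 1) (V 0), hs, hr]
        linarith)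
    a (by simpa using ha)
  refine ⟨{Q | ∀ i, 0 < cross2 (V (i + 1)) (V (i + 2)) Q} ∩
    {Q | ∀ x : T, 0 < cross2 (V (σ x + 2)) Q x ∧ 0 < cross2 Q (V (σ x + 1)) x}, ?_, ?_, ?_⟩
  · simp only [Set.ofPred_forall]
    exact (isOpen_iInter_of_finite fun i =>
        isOpen_lt continuous_const (continuous_cross2_right _ _)).inter
      (isOpen_iInter_of_finite fun x =>
        (isOpen_lt continuous_const (continuous_cross2_middle _ _)).inter
        (isOpen_lt continuous_const (continuous_cross2_left _ _)))
  · have hw0 := hw 0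
    have hw1 := hw 1
    have hw2 := hw 2
    set W := w 0 + w 1 + w 2 with hWdef
    have hW : 0 < W := by positivity
    have e1 : ∀ A B : ℝ × ℝ, cross2 A B (W⁻¹ • (w 0 • V 0 + w 1 • V 1 + w 2 • V 2)) = W⁻¹ *
        (w 0 * cross2 A B (V 0) + w 1 * cross2 A B (V 1) + w 2 * cross2 A B (V 2)) := by
      intro A B
      simp [cross2]
      field_simp
      rw [hWdef]
      ring
    have e2 : ∀ B x : ℝ × ℝ, cross2 B (W⁻¹ • (w 0 • V 0 + w 1 • V 1 + w 2 • V 2)) x = W⁻¹ *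
        (w 0 * cross2 B (V 0) x + w 1 * cross2 B (V 1) x + w 2 * cross2 B (V 2) x) := by
      intro B x
      rw [cross2_rotate, cross2_rotate, e1]
      simp only [← cross2_rotate x B]
    have e3 : ∀ B x : ℝ × ℝ, cross2 (W⁻¹ • (w 0 • V 0 + w 1 • V 1 + w 2 • V 2)) B x = W⁻¹ *
        (w 0 * cross2 (V 0) B x + w 1 * cross2 (V 1) B x + w 2 * cross2 (V 2) B x) := by
      intro B x
      rw [cross2_rotate, e1]
      simp only [cross2_rotate _ B x]
    have hD1 : 0 < cross2 (V 1) (V 2) (V 0) := cross2_rotate (V 0) (V 1) (V 2) ▸ hD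
    have hD2 : 0 < cross2 (V 2) (V 0) (V 1) := cross2_rotate (V 1) (V 2) (V 0) ▸ hD1
    refine ⟨W⁻¹ • (w 0 • V 0 + w 1 • V 1 + w 2 • V 2), fun i => ?_, fun x => ?_⟩
    · rw [e1]
      fin_cases i <;> simp [cross2_self_outer, cross2_self_right] <;> positivity
    · have g1 := hopt x (σ x + 1)
      have g2 := hopt x (σ x + 2)
      rw [e2, e3]
      have s01 := cross2_swap (V 1) (V 0) x
      have s12 := cross2_swap (V 2) (V 1) x
      have s20 := cross2_swap (V 0) (V 2) x
      have hW' := inv_pos.2 hW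
      generalize σ x = i at g1 g2 ⊢
      constructor <;> refine mul_pos hW' ?_ <;> fin_cases i <;>
        simp [cross2_self_left, s01, s12, s20] at g1 g2 ⊢ <;> linarith
  · rintro Q ⟨hQ1, hQ2⟩
    refine ⟨hQ1, fun i => ?_⟩
    rw [← hσ i]
    have hiff : ∀ x : T, (0 < cross2 (V (i + 2)) Q x ∧ 0 < cross2 Q (V (i + 1)) x) ↔
        σ x = i := by
      intro x
      constructor
      · rintro ⟨h1, h2⟩
        obtain ⟨h3, h4⟩ := hQ2 x
        generalize σ x = j at h3 h4
        rw [cross2_swap] at h2 h4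
        fin_cases i <;> fin_cases j <;> simp at h1 h2 h3 h4 ⊢ <;> linarith
      · rintro rfl
        exact hQ2 x
    symm
    refine Finset.card_bij (fun x _ => x.1) (fun x hx => ?_) (fun x _ y _ h => Subtype.ext h)
      fun x hx => ?_
    · rw [Finset.mem_filter]
      exact ⟨x.2, (hiff x).2 (Finset.mem_filter.1 hx).2⟩
    · rw [Finset.mem_filter] at hx
      exact ⟨⟨x, hx.1⟩, Finset.mem_filter.2 ⟨Finset.mem_univ _, (hiff ⟨x, hx.1⟩).1 hx.2⟩, rfl⟩

lemma cross2_barycentric_right (X Y Z Q a b : ℝ × ℝ) :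
    cross2 X Y Z * cross2 a b Q = cross2 Y Z Q * cross2 a b X + cross2 Z X Q * cross2 a b Y +
      cross2 X Y Q * cross2 a b Z := by
  unfold cross2; ring

lemma cross2_barycentric_middle (X Y Z Q a b : ℝ × ℝ) :
    cross2 X Y Z * cross2 a Q b = cross2 Y Z Q * cross2 a X b + cross2 Z X Q * cross2 a Y b +
      cross2 X Y Q * cross2 a Z b := by
  unfold cross2; ring

lemma cross2_barycentric_left (X Y Z Q a b : ℝ × ℝ) :
    cross2 X Y Z * cross2 Q a b = cross2 Y Z Q * cross2 X a b + cross2 Z X Q * cross2 Y a b +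
      cross2 X Y Q * cross2 Z a b := by
  unfold cross2; ring

namespace IsCCWCycle

variable {N : ℕ} {p : ℕ → ℝ × ℝ}

lemma triangle_pos (h : IsCCWCycle N p) {j : ℕ} (hj : 0 < j) (hjN : j + 1 < N) :
    0 < cross2 (p 0) (p j) (p (j + 1)) :=
  h.fan_pos hj (Nat.lt_succ_self j) hjN

lemma fan_nonneg (h : IsCCWCycle N p) {a b : ℕ} (hab : a ≤ b) (hb : b < N) :
    0 ≤ cross2 (p 0) (p a) (p b) := by
  rcases Nat.eq_zero_or_pos a with rfl | ha
  · rw [cross2_self_left]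
  rcases hab.eq_or_lt with rfl | hab
  · rw [cross2_self_right]
  · exact (h.fan_pos ha hab hb).le

/-- For a point inside the polygon, the diagonals from `p 0` having it on their right come after
those having it on their left. -/
lemma fan_neg_succ (h : IsCCWCycle N p) {j : ℕ} (hj : 0 < j) (hjN : j + 1 < N) {x : ℝ × ℝ}
    (hx : ∀ i < N, 0 < cross2 (p i) (p (i + 1)) x) (hneg : cross2 (p 0) (p j) x < 0) :
    cross2 (p 0) (p (j + 1)) x < 0 := by
  have hx0 : 0 < cross2 (p 0) (p 1) x := hx 0 (by omega)
  have hj1 : 1 < j := by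
    by_contra hle
    obtain rfl : j = 1 := by omega
    linarith
  have h1 := h.fan_pos one_pos hj1 (by omega)
  have h2 := h.fan_pos one_pos (show 1 < j + 1 by omega) hjN
  have h3 := h.triangle_pos hj hjN
  have h4 := cross2_pluecker (p 0) (p 1) (p j) (p (j + 1)) x
  by_contra hge
  have h5 := mul_nonneg h1.le (not_lt.1 hge)
  have h6 := mul_pos h2 (neg_pos.2 hneg)
  have h7 := mul_pos hx0 h3
  linarith

/-- The vertices of the polygon `p 0, …, p j, Q`. -/
def leftPath (p : ℕ → ℝ × ℝ) (j : ℕ) (Q : ℝ × ℝ) (k : ℕ) : ℝ × ℝ :=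
  if k ≤ j then p k else if k = j + 1 then Q else p 0

/-- The vertices of the polygon `p 0, Q, p (j + 1), …`. -/
def rightPath (p : ℕ → ℝ × ℝ) (j : ℕ) (Q : ℝ × ℝ) (k : ℕ) : ℝ × ℝ :=
  if k = 0 then p 0 else if k = 1 then Q else p (j + k - 1)

lemma leftPath_of_le {j k : ℕ} (Q : ℝ × ℝ) (hk : k ≤ j) : leftPath p j Q k = p k := if_pos hk

lemma leftPath_succ (j : ℕ) (Q : ℝ × ℝ) : leftPath p j Q (j + 1) = Q := by
  simp [leftPath]

lemma leftPath_add_two (j : ℕ) (Q : ℝ × ℝ) : leftPath p j Q (j + 1 + 1) = p 0 := by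
  simp [leftPath]

lemma rightPath_add_two (j : ℕ) (Q : ℝ × ℝ) (k : ℕ) :
    rightPath p j Q (k + 2) = p (j + 1 + k) := by
  simp only [rightPath]
  rw [if_neg (by omega), if_neg (by omega)]
  congr 1
  omega

lemma leftPath_isCCWCycle (h : IsCCWCycle N p) {j : ℕ} (hj : 0 < j) (hjN : j + 1 < N)
    {Q : ℝ × ℝ} (hZ : 0 < cross2 (p 0) (p j) Q) (hX : 0 < cross2 (p j) (p (j + 1)) Q)
    (hY : 0 < cross2 (p (j + 1)) (p 0) Q) : IsCCWCycle (j + 2) (leftPath p j Q) := by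
  have hD := h.triangle_pos hj hjN
  refine ⟨by omega, by rw [leftPath_add_two, leftPath_of_le Q (Nat.zero_le j)], ?_⟩
  intro i hi k hk hki hki1 hlast
  refine pos_of_mul_pos_right (a := cross2 (p 0) (p j) (p (j + 1))) ?_ hD.le
  obtain hij | rfl | rfl : i < j ∨ i = j ∨ i = j + 1 := by omega
  · rw [leftPath_of_le Q hij.le, leftPath_of_le Q hij]
    rcases (Nat.le_of_lt_succ hk).eq_or_lt with rfl | hk
    · rw [leftPath_succ, cross2_barycentric_right]
      have h1 := mul_nonneg hX.le (h.nonneg (i := i) (k := 0) (by omega) (by omega))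
      have h2 := mul_nonneg hY.le (h.nonneg (i := i) (k := j) (by omega) (by omega))
      have h3 := mul_pos hZ
        (h.pos i (by omega) (j + 1) (by omega) (by omega) (by omega) (by omega))
      linarith
    · rw [leftPath_of_le Q (Nat.le_of_lt_succ hk)]
      exact mul_pos hD (h.pos i (by omega) k (by omega) hki hki1 (by omega))
  · rw [leftPath_of_le Q le_rfl, leftPath_succ, leftPath_of_le Q (by omega),
      cross2_barycentric_middle, cross2_self_left, cross2_rotate (p i) (p 0)]
    have h1 := mul_nonneg hX.le (h.fan_nonneg (a := k) (b := i) (by omega) (by omega))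
    have h3 := mul_pos hZ (h.pos i (by omega) k (by omega) (by omega) (by omega) (by omega))
    linarith
  · have hk0 : k ≠ 0 := hlast rfl
    rw [leftPath_succ, leftPath_add_two, leftPath_of_le Q (by omega), cross2_barycentric_left,
      cross2_self_left, cross2_rotate (p j) (p 0) (p k), cross2_rotate (p (j + 1)) (p 0) (p k)]
    have h2 := mul_nonneg hY.le (h.fan_nonneg (a := k) (b := j) (by omega) (by omega))
    have h3 := mul_pos hZ (h.fan_pos (a := k) (b := j + 1) (by omega) (by omega) hjN)
    linarith

lemma rightPath_isCCWCycle (h : IsCCWCycle N p) {j : ℕ} (hj : 0 < j) (hjN : j + 1 < N)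
    {Q : ℝ × ℝ} (hZ : 0 < cross2 (p 0) (p j) Q) (hX : 0 < cross2 (p j) (p (j + 1)) Q)
    (hY : 0 < cross2 (p (j + 1)) (p 0) Q) : IsCCWCycle (N + 1 - j) (rightPath p j Q) := by
  have hD := h.triangle_pos hj hjN
  obtain ⟨M, rfl⟩ : ∃ M, N = j + 1 + M := ⟨N - (j + 1), by omega⟩
  have hlen : j + 1 + M + 1 - j = M + 2 := by omega
  have hr0 : rightPath p j Q 0 = p 0 := rfl
  have hr1 : rightPath p j Q 1 = Q := rfl
  rw [hlen]
  refine ⟨by omega, by rw [rightPath_add_two, h.closed, hr0], ?_⟩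
  intro i hi k hk hki hki1 hlast
  refine pos_of_mul_pos_right (a := cross2 (p 0) (p j) (p (j + 1))) ?_ hD.le
  obtain rfl | rfl | ⟨i, rfl⟩ : i = 0 ∨ i = 1 ∨ ∃ l, i = l + 2 := by
    rcases i with _ | _ | i <;> simp
  · obtain ⟨k, rfl⟩ : ∃ l, k = l + 2 := ⟨k - 2, by omega⟩
    rw [zero_add, hr0, hr1, rightPath_add_two, cross2_barycentric_middle, cross2_self_left]
    have h2 := mul_pos hY (h.fan_pos (a := j) (b := j + 1 + k) hj (by omega) (by omega))
    have h3 := mul_nonneg hZ.le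
      (h.fan_nonneg (a := j + 1) (b := j + 1 + k) (by omega) (by omega))
    linarith
  · rw [hr1, show 1 + 1 = 0 + 2 from rfl, rightPath_add_two, add_zero,
      cross2_barycentric_left, cross2_self_left]
    obtain rfl | ⟨k, rfl⟩ : k = 0 ∨ ∃ l, k = l + 2 := by
      rcases k with _ | _ | k <;> simp_all
    · rw [hr0, cross2_self_outer]
      have h2 := mul_pos hY
        (h.pos j (by omega) 0 (by omega) (by omega) (by omega) (by omega))
      linarith
    · rw [rightPath_add_two]
      have h1 := mul_nonneg hX.le
        (h.fan_nonneg (a := j + 1) (b := j + 1 + k) (by omega) (by omega))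
      have h2 := mul_pos hY
        (h.pos j (by omega) (j + 1 + k) (by omega) (by omega) (by omega) (by omega))
      linarith
  · rw [show i + 2 + 1 = (i + 1) + 2 from rfl, rightPath_add_two, rightPath_add_two,
      ← add_assoc]
    obtain rfl | rfl | ⟨k, rfl⟩ : k = 0 ∨ k = 1 ∨ ∃ l, k = l + 2 := by
      rcases k with _ | _ | k <;> simp
    · rw [hr0]
      exact mul_pos hD (h.pos _ (by omega) _ (by omega) (by omega) (by omega) (by omega))
    · rw [hr1, cross2_barycentric_right]
      have h1 := mul_nonneg hX.le (h.nonneg (i := j + 1 + i) (k := 0) (by omega) (by omega))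
      have h2 := mul_pos hY
        (h.pos (j + 1 + i) (by omega) j (by omega) (by omega) (by omega) (by omega))
      have h3 := mul_nonneg hZ.le
        (h.nonneg (i := j + 1 + i) (k := j + 1) (by omega) (by omega))
      linarith
    · rw [rightPath_add_two]
      exact mul_pos hD (h.pos _ (by omega) _ (by omega) (by omega) (by omega) (by omega))

lemma forall_leftPath_iff {j : ℕ} (hjN : j + 1 < N) {Q x : ℝ × ℝ}
    (hx : ∀ i < N, 0 < cross2 (p i) (p (i + 1)) x) :
    (∀ i < j + 2, 0 < cross2 (leftPath p j Q i) (leftPath p j Q (i + 1)) x) ↔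
      0 < cross2 (p j) Q x ∧ 0 < cross2 Q (p 0) x := by
  constructor
  · intro h
    have h1 := h j (by omega)
    have h2 := h (j + 1) (by omega)
    rw [leftPath_of_le Q le_rfl, leftPath_succ] at h1
    rw [leftPath_succ, leftPath_add_two] at h2
    exact ⟨h1, h2⟩
  · rintro ⟨h1, h2⟩ i hi
    obtain hij | rfl | rfl : i < j ∨ i = j ∨ i = j + 1 := by omega
    · rw [leftPath_of_le Q hij.le, leftPath_of_le Q hij]
      exact hx i (by omega)
    · rwa [leftPath_of_le Q le_rfl, leftPath_succ]
    · rwa [leftPath_succ, leftPath_add_two]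

lemma forall_rightPath_iff {j : ℕ} (hjN : j + 1 < N) {Q x : ℝ × ℝ}
    (hx : ∀ i < N, 0 < cross2 (p i) (p (i + 1)) x) :
    (∀ i < N + 1 - j, 0 < cross2 (rightPath p j Q i) (rightPath p j Q (i + 1)) x) ↔
      0 < cross2 (p 0) Q x ∧ 0 < cross2 Q (p (j + 1)) x := by
  constructor
  · intro h
    exact ⟨h 0 (by omega), h 1 (by omega)⟩
  · rintro ⟨h1, h2⟩ i hi
    obtain rfl | rfl | ⟨i, rfl⟩ : i = 0 ∨ i = 1 ∨ ∃ l, i = l + 2 := by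
      rcases i with _ | _ | i <;> simp
    · exact h1
    · exact h2
    · rw [show i + 2 + 1 = (i + 1) + 2 from rfl, rightPath_add_two, rightPath_add_two,
        ← add_assoc]
      exact hx _ (by omega)

end IsCCWCycle

lemma IsConvexPolygonCCW.isCCWCycle {n : ℕ} [NeZero n] {v : Fin n → ℝ × ℝ}
    (hconv : IsConvexPolygonCCW v) : IsCCWCycle n fun k => v (Fin.ofNat n k) := by
  obtain ⟨hn, hpos⟩ := hconv
  refine ⟨hn, by congr 1; ext; simp, ?_⟩
  intro i hi k hk hki hki1 hlast
  have hsucc : Fin.ofNat n (i + 1) = Fin.ofNat n i + 1 := by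
    ext; simp [Fin.val_add]
  simp only [hsucc]
  refine hpos _ _ ?_ ?_
  · intro h
    have := congrArg Fin.val h
    simp only [Fin.val_ofNat, Nat.mod_eq_of_lt hi, Nat.mod_eq_of_lt hk] at this
    exact hki this
  · rw [← hsucc]
    intro h
    have := congrArg Fin.val h
    simp only [Fin.val_ofNat, Nat.mod_eq_of_lt hk] at this
    by_cases hin : i + 1 = n
    · rw [hin, Nat.mod_self] at this
      exact hlast hin this
    · rw [Nat.mod_eq_of_lt (by omega)] at this
      exact hki1 this

lemma sign_cases_of_triangle {X Y Z : ℝ × ℝ} {A : Finset (ℝ × ℝ)}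
    (hAY : ∀ x ∈ A, cross2 Z X x ≠ 0) (hAZ : ∀ x ∈ A, cross2 X Y x ≠ 0)
    (hA : ∀ x ∈ A, cross2 X Y x < 0 → 0 < cross2 Z X x) :
    ∀ x ∈ A, (cross2 X Y x < 0 ∧ 0 < cross2 Z X x) ∨
      (0 < cross2 X Y x ∧ cross2 Z X x < 0) ∨ (0 < cross2 X Y x ∧ 0 < cross2 Z X x) := by
  intro x hx
  have h := hA x hx
  rcases (hAZ x hx).lt_or_gt with h1 | h1 <;> rcases (hAY x hx).lt_or_gt with h2 | h2 <;>
    simp_all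

lemma card_eq_of_triangle {X Y Z : ℝ × ℝ} {A : Finset (ℝ × ℝ)}
    (hAY : ∀ x ∈ A, cross2 Z X x ≠ 0) (hAZ : ∀ x ∈ A, cross2 X Y x ≠ 0)
    (hA : ∀ x ∈ A, cross2 X Y x < 0 → 0 < cross2 Z X x) :
    A.card = (A.filter fun x => cross2 X Y x < 0).card +
      (A.filter fun x => cross2 Z X x < 0).card +
      (A.filter fun x => 0 < cross2 X Y x ∧ 0 < cross2 Z X x).card := by
  have hcases := sign_cases_of_triangle hAY hAZ hA
  rw [← Finset.card_union_of_disjoint, ← Finset.card_union_of_disjoint]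
  · congr 1
    ext x
    simp only [Finset.mem_union, Finset.mem_filter]
    constructor
    · intro hx
      rcases hcases x hx with h | h | h
      · exact Or.inl (Or.inl ⟨hx, h.1⟩)
      · exact Or.inl (Or.inr ⟨hx, h.2⟩)
      · exact Or.inr ⟨hx, h⟩
    · rintro ((h | h) | h) <;> exact h.1
  · rw [Finset.disjoint_left]
    intro x h1 h2
    simp only [Finset.mem_union, Finset.mem_filter] at h1 h2
    rcases h1 with h1 | h1
    · exact lt_asymm h1.2 h2.2.1
    · exact lt_asymm h1.2 h2.2.2
  · rw [Finset.disjoint_left]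
    intro x h1 h2
    simp only [Finset.mem_filter] at h1 h2
    exact lt_asymm h2.2 (hA x h1.1 h1.2)

/-- Points are counted separately to the right of `XY`, to the right of `ZX` and inside the
triangle `XYZ` when their position relative to an interior point `Q` is determined. -/
lemma card_filter_of_triangle {X Y Z Q : ℝ × ℝ} (hD : 0 < cross2 X Y Z)
    (hX : 0 < cross2 Y Z Q) (hY : 0 < cross2 Z X Q) (hZ : 0 < cross2 X Y Q)
    (A : Finset (ℝ × ℝ)) (hAX : ∀ x ∈ A, 0 < cross2 Y Z x) (hAY : ∀ x ∈ A, cross2 Z X x ≠ 0)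
    (hAZ : ∀ x ∈ A, cross2 X Y x ≠ 0) (hA : ∀ x ∈ A, cross2 X Y x < 0 → 0 < cross2 Z X x) :
    (A.filter fun x => 0 < cross2 Y Q x ∧ 0 < cross2 Q X x).card =
        (A.filter fun x => cross2 X Y x < 0).card +
        ((A.filter fun x => 0 < cross2 X Y x ∧ 0 < cross2 Z X x).filter
          fun x => 0 < cross2 Y Q x ∧ 0 < cross2 Q X x).card ∧
      (A.filter fun x => 0 < cross2 Z Q x ∧ 0 < cross2 Q Y x) =
        ((A.filter fun x => 0 < cross2 X Y x ∧ 0 < cross2 Z X x).filter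
          fun x => 0 < cross2 Z Q x ∧ 0 < cross2 Q Y x) ∧
      (A.filter fun x => 0 < cross2 X Q x ∧ 0 < cross2 Q Z x).card =
        (A.filter fun x => cross2 Z X x < 0).card +
        ((A.filter fun x => 0 < cross2 X Y x ∧ 0 < cross2 Z X x).filter
          fun x => 0 < cross2 X Q x ∧ 0 < cross2 Q Z x).card := by
  have hYQ : ∀ x, 0 < cross2 Y Q x ↔
      cross2 Y Z Q * cross2 X Y x < cross2 X Y Q * cross2 Y Z x := fun x => by
    rw [← mul_pos_iff_of_pos_left hD, cross2_barycentric_middle, cross2_self_left,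
      cross2_swap Y X]
    constructor <;> intro h <;> linarith
  have hZQ : ∀ x, 0 < cross2 Z Q x ↔
      cross2 Z X Q * cross2 Y Z x < cross2 Y Z Q * cross2 Z X x := fun x => by
    rw [← mul_pos_iff_of_pos_left hD, cross2_barycentric_middle, cross2_self_left,
      cross2_swap Z Y]
    constructor <;> intro h <;> linarith
  have hXQ : ∀ x, 0 < cross2 X Q x ↔
      cross2 X Y Q * cross2 Z X x < cross2 Z X Q * cross2 X Y x := fun x => by
    rw [← mul_pos_iff_of_pos_left hD, cross2_barycentric_middle, cross2_self_left,
      cross2_swap X Z]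
    constructor <;> intro h <;> linarith
  have hQY : ∀ x, 0 < cross2 Q Y x ↔
      cross2 X Y Q * cross2 Y Z x < cross2 Y Z Q * cross2 X Y x := fun x => by
    rw [← mul_pos_iff_of_pos_left hD, cross2_barycentric_left, cross2_self_left,
      cross2_swap Z Y]
    constructor <;> intro h <;> linarith
  have hQZ : ∀ x, 0 < cross2 Q Z x ↔
      cross2 Y Z Q * cross2 Z X x < cross2 Z X Q * cross2 Y Z x := fun x => by
    rw [← mul_pos_iff_of_pos_left hD, cross2_barycentric_left, cross2_self_left,
      cross2_swap X Z]
    constructor <;> intro h <;> linarith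
  have hQX : ∀ x, 0 < cross2 Q X x ↔
      cross2 Z X Q * cross2 X Y x < cross2 X Y Q * cross2 Z X x := fun x => by
    rw [← mul_pos_iff_of_pos_left hD, cross2_barycentric_left, cross2_self_left,
      cross2_swap Y X]
    constructor <;> intro h <;> linarith
  have hcases := sign_cases_of_triangle hAY hAZ hA
  have hR : ∀ x ∈ A, cross2 X Y x < 0 → (0 < cross2 Y Q x ∧ 0 < cross2 Q X x) ∧
      ¬ 0 < cross2 Q Y x ∧ ¬ 0 < cross2 X Q x := by
    intro x hx hneg
    have h1 := hAX x hx
    have h2 := hA x hx hneg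
    rw [hYQ, hQX, hQY, hXQ, not_lt, not_lt]
    have m1 := mul_pos hX (neg_pos.2 hneg)
    have m2 := mul_pos hY (neg_pos.2 hneg)
    have m3 := mul_pos hZ h1
    have m4 := mul_pos hZ h2
    refine ⟨⟨?_, ?_⟩, ?_, ?_⟩ <;> linarith
  have hL : ∀ x ∈ A, 0 < cross2 X Y x → cross2 Z X x < 0 →
      (0 < cross2 X Q x ∧ 0 < cross2 Q Z x) ∧ ¬ 0 < cross2 Q X x ∧ ¬ 0 < cross2 Z Q x := by
    intro x hx hp hneg
    have h1 := hAX x hx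
    rw [hXQ, hQZ, hQX, hZQ, not_lt, not_lt]
    have m1 := mul_pos hX (neg_pos.2 hneg)
    have m2 := mul_pos hZ (neg_pos.2 hneg)
    have m3 := mul_pos hY h1
    have m4 := mul_pos hY hp
    refine ⟨⟨?_, ?_⟩, ?_, ?_⟩ <;> linarith
  refine ⟨?_, ?_, ?_⟩
  · rw [← Finset.card_union_of_disjoint]
    · congr 1
      ext x
      simp only [Finset.mem_union, Finset.mem_filter]
      constructor
      · rintro ⟨hx, h1, h2⟩
        rcases hcases x hx with h | h | h
        · exact Or.inl ⟨hx, h.1⟩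
        · exact absurd h2 (hL x hx h.1 h.2).2.1
        · exact Or.inr ⟨⟨hx, h⟩, h1, h2⟩
      · rintro (⟨hx, h⟩ | ⟨⟨hx, -⟩, h⟩)
        · exact ⟨hx, (hR x hx h).1⟩
        · exact ⟨hx, h⟩
    · rw [Finset.disjoint_left]
      intro x h1 h2
      simp only [Finset.mem_filter] at h1 h2
      exact lt_asymm h1.2 h2.1.2.1
  · ext x
    simp only [Finset.mem_filter]
    constructor
    · rintro ⟨hx, h1, h2⟩
      rcases hcases x hx with h | h | h
      · exact absurd h2 (hR x hx h.1).2.1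
      · exact absurd h1 (hL x hx h.1 h.2).2.2
      · exact ⟨⟨hx, h⟩, h1, h2⟩
    · rintro ⟨⟨hx, -⟩, h⟩
      exact ⟨hx, h⟩
  · rw [← Finset.card_union_of_disjoint]
    · congr 1
      ext x
      simp only [Finset.mem_union, Finset.mem_filter]
      constructor
      · rintro ⟨hx, h1, h2⟩
        rcases hcases x hx with h | h | h
        · exact absurd h1 (hR x hx h.1).2.2
        · exact Or.inl ⟨hx, h.2⟩
        · exact Or.inr ⟨⟨hx, h⟩, h1, h2⟩
      · rintro (⟨hx, h⟩ | ⟨⟨hx, -⟩, h⟩)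
        · rcases hcases x hx with h' | h' | h'
          · exact absurd h'.2 h.not_gt
          · exact ⟨hx, (hL x hx h'.1 h).1⟩
          · exact absurd h'.2 h.not_gt
        · exact ⟨hx, h⟩
    · rw [Finset.disjoint_left]
      intro x h1 h2
      simp only [Finset.mem_filter] at h1 h2
      exact lt_asymm h1.2 h2.1.2.2

/-- A discrete crossing argument: the partial sums of `c` overtake `R` at some diagonal. -/
lemma exists_crossing_index {n : ℕ} (hn : 3 ≤ n) (R C : ℕ → ℕ) (h1 : R 1 < C 1)
    (hlast : C (n - 1) ≤ R (n - 1)) :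
    ∃ j, 0 < j ∧ j + 1 < n ∧ R j < C j ∧ C (j + 1) ≤ R (j + 1) := by
  classical
  have hex : ∃ k, C (k + 1) ≤ R (k + 1) := ⟨n - 2, by
    rwa [show n - 2 + 1 = n - 1 by omega]⟩
  obtain ⟨k, hk, hkmin⟩ : ∃ k, C (k + 1) ≤ R (k + 1) ∧ ∀ l < k, ¬ C (l + 1) ≤ R (l + 1) :=
    ⟨Nat.find hex, Nat.find_spec hex, fun l hl => Nat.find_min hex hl⟩
  have hk0 : 0 < k := by
    rcases Nat.eq_zero_or_pos k with rfl | hk0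
    · exact absurd hk (not_le.2 h1)
    · exact hk0
  have hkn : k ≤ n - 2 := not_lt.1 fun hlt => hkmin _ hlt (by
    rwa [show n - 2 + 1 = n - 1 by omega])
  have hprev := hkmin (k - 1) (by omega)
  rw [Nat.sub_add_cancel hk0, not_le] at hprev
  exact ⟨k, hk0, by omega, hprev, hk⟩

/-- given a convex polygon `v 0, …, v (n-1)` (listed counterclockwise,
`v 0` playing the role of `P₁`), `m` interior points `A` in general⁺ position with the
vertices, and positive integers `c 0, …, c (n-1)` summing to `m`, there are an index `j`
(`1 ≤ j ≤ n - 2`, so that `v j` is one of `P₂, …, P_{n-1}` as a 1-indexed vertex) and a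
point `Q` inside the triangle `v 0, v j, v (j+1)` such that the polygon
`v 0 ⋯ v j Q` contains exactly `c 0 + ⋯ + c (j-1)` points of `A`, the triangle
`v j, Q, v (j+1)` exactly `c j` of them, the polygon `v 0, Q, v (j+1), …, v (n-1)`
exactly `c (j+1) + ⋯ + c (n-1)` of them, and the configuration enlarged by `Q` is
still in general⁺ position. -/
theorem stmt10 {n : ℕ} [NeZero n] (v : Fin n → ℝ × ℝ) (hconv : IsConvexPolygonCCW v)
    (A : Finset (ℝ × ℝ)) (m : ℕ) (hm : A.card = m)
    (hA : ↑A ⊆ interior (convexHull ℝ (Set.range v)))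
    (hgen : GenPlusPos (Set.range v ∪ ↑A))
    (c : Fin n → ℕ) (hcpos : ∀ i, 0 < c i) (hsum : ∑ i, c i = m) :
    ∃ j : Fin n, 1 ≤ j.val ∧ j.val ≤ n - 2 ∧
      ∃ Q ∈ interior (convexHull ℝ ({v 0, v j, v (j + 1)} : Set (ℝ × ℝ))),
        ((↑A : Set (ℝ × ℝ)) ∩ polyInteriorL
            ((List.ofFn fun k : Fin (j.val + 1) => v (Fin.castLE j.isLt k)) ++ [Q])).ncard =
          ∑ k ∈ Finset.univ.filter (fun k : Fin n => k < j), c k ∧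
        ((↑A : Set (ℝ × ℝ)) ∩
            interior (convexHull ℝ ({v j, Q, v (j + 1)} : Set (ℝ × ℝ)))).ncard = c j ∧
        ((↑A : Set (ℝ × ℝ)) ∩ polyInteriorL
            (v 0 :: Q :: List.ofFn
              (fun k : Fin (n - 1 - j.val) =>
                v ⟨j.val + 1 + k.val, by have := k.isLt; have := j.isLt; omega⟩))).ncard =
          ∑ k ∈ Finset.univ.filter (fun k : Fin n => j < k), c k ∧
        GenPlusPos (Set.range v ∪ ↑A ∪ {Q}) := by
  classical
  have hcyc := hconv.isCCWCycle
  set p : ℕ → ℝ × ℝ := fun k => v (Fin.ofNat n k) with hp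
  have hn := hcyc.three_le
  have hpv : ∀ k (hk : k < n), p k = v ⟨k, hk⟩ := fun k hk => by
    simp only [hp]
    congr 1
    ext
    simp [Nat.mod_eq_of_lt hk]
  have hpmem : ∀ k, p k ∈ Set.range v := fun k => ⟨_, rfl⟩
  have hAedge : ∀ x ∈ A, ∀ i < n, 0 < cross2 (p i) (p (i + 1)) x := by
    intro x hx i hi
    refine cross2_pos_of_mem_interior (hcyc.ne_succ hi) ?_ (hA hx)
    rintro _ ⟨k, rfl⟩
    rw [← hpv k k.2]
    exact hcyc.nonneg hi k.2.le
  have hAne : ∀ x ∈ A, ∀ k < n, p k ≠ x := by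
    intro x hx k hk h
    have := hAedge x hx k hk
    rw [← h, cross2_self_outer] at this
    exact lt_irrefl _ this
  have hdiag : ∀ x ∈ A, ∀ k, 0 < k → k < n → cross2 (p 0) (p k) x ≠ 0 := by
    intro x hx k hk hkn
    refine hgen.1.cross2_ne_zero (Or.inl (hpmem 0)) (Or.inl (hpmem k)) (Or.inr hx) ?_
      (hAne x hx 0 (by omega)) (hAne x hx k hkn)
    intro h
    by_cases hk1 : k + 1 < n
    · have := hcyc.triangle_pos hk hk1
      rw [h, cross2_self_left] at this
      exact lt_irrefl _ this
    · have := hcyc.fan_pos one_pos (show 1 < k by omega) hkn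
      rw [← h, cross2_self_outer] at this
      exact lt_irrefl _ this
  let R : ℕ → ℕ := fun k => (A.filter fun x => cross2 (p 0) (p k) x < 0).card
  let C : ℕ → ℕ := fun k => ∑ i ∈ Finset.univ.filter (fun i : Fin n => i.val < k), c i
  have hR1 : R 1 = 0 := by
    rw [Finset.card_eq_zero, Finset.filter_eq_empty_iff]
    exact fun x hx => (hAedge x hx 0 (by omega)).not_gt
  have hC1 : 0 < C 1 :=
    Finset.sum_pos (fun i _ => hcpos i) ⟨0, by simp⟩
  have hRlast : R (n - 1) = m := by
    rw [← hm]
    refine congrArg Finset.card (Finset.filter_true_of_mem fun x hx => ?_)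
    have h := hAedge x hx (n - 1) (by omega)
    rw [Nat.sub_add_cancel (by omega), hcyc.closed, cross2_swap] at h
    linarith
  have hClast : C (n - 1) ≤ m := by
    rw [← hsum]
    exact Finset.sum_le_sum_of_subset (Finset.filter_subset _ _)
  obtain ⟨j, hj, hjn, hRC, hCR⟩ := exists_crossing_index hn R C (by omega) (by omega)
  have hj' : j < n := by omega
  let J : Fin n := ⟨j, hj'⟩
  have hv0 : v 0 = p 0 := by
    rw [hpv 0 (by omega)]
    rfl
  have hvJ : v J = p j := (hpv j hj').symm
  have hvJ1 : v (J + 1) = p (j + 1) := by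
    simp only [hp]
    congr 1
    ext
    simp [Fin.val_add, J]
  have hCsucc : C (j + 1) = C j + c J := by
    have : Finset.univ.filter (fun i : Fin n => i.val < j + 1) =
        insert J (Finset.univ.filter fun i : Fin n => i.val < j) := by
      ext i
      simp only [Finset.mem_filter, Finset.mem_insert, Finset.mem_univ, true_and, Fin.ext_iff, J]
      omega
    simp only [C]
    rw [this, Finset.sum_insert (by simp [J]), add_comm]
  have hCrest : C (j + 1) + ∑ k ∈ Finset.univ.filter (fun k : Fin n => J < k), c k = m := by
    rw [← hsum, ← Finset.sum_filter_add_sum_filter_not Finset.univ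
      (fun i : Fin n => i.val < j + 1)]
    congr 2
    ext i
    simp only [Finset.mem_filter, Finset.mem_univ, true_and, Fin.lt_def, J]
    omega
  have hD := hcyc.triangle_pos hj hjn
  set T := A.filter fun x => 0 < cross2 (p 0) (p j) x ∧ 0 < cross2 (p (j + 1)) (p 0) x with hT
  have hAX : ∀ x ∈ A, 0 < cross2 (p j) (p (j + 1)) x := fun x hx => hAedge x hx j hj'
  have hAZ : ∀ x ∈ A, cross2 (p 0) (p j) x ≠ 0 := fun x hx => hdiag x hx j hj hj'
  have hAY : ∀ x ∈ A, cross2 (p (j + 1)) (p 0) x ≠ 0 := fun x hx => by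
    rw [cross2_swap, neg_ne_zero]
    exact hdiag x hx (j + 1) (by omega) hjn
  have hAneg : ∀ x ∈ A, cross2 (p 0) (p j) x < 0 → 0 < cross2 (p (j + 1)) (p 0) x :=
    fun x hx h => by
      rw [cross2_swap, neg_pos]
      exact hcyc.fan_neg_succ hj hjn (hAedge x hx) h
  set L := (A.filter fun x => cross2 (p (j + 1)) (p 0) x < 0).card with hL
  have hLR : L + R (j + 1) = m := by
    rw [← hm, add_comm, ← Finset.card_filter_add_card_filter_not
      (fun x => cross2 (p 0) (p (j + 1)) x < 0)]
    refine congrArg₂ _ rfl (congrArg Finset.card (Finset.filter_congr fun x hx => ?_))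
    rw [cross2_swap, neg_lt_zero, not_lt]
    exact ⟨le_of_lt, fun h => lt_of_le_of_ne h (hdiag x hx (j + 1) (by omega) hjn).symm⟩
  have hcard : A.card = R j + L + T.card := card_eq_of_triangle hAY hAZ hAneg
  obtain ⟨O, hO, hOne, hOQ⟩ := exists_open_triangle_partition hgen
    ![p 0, p j, p (j + 1)] (fun i => by fin_cases i <;> exact Or.inl (hpmem _)) hD T
    (fun x hx => Or.inr (Finset.mem_filter.1 hx).1)
    (fun x hx i => by
      obtain ⟨hxA, hxZ, hxY⟩ := Finset.mem_filter.1 hx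
      fin_cases i
      exacts [hAX x hxA, hxY, hxZ])
    ![c J, (∑ k ∈ Finset.univ.filter (fun k : Fin n => J < k), c k) - L, C j - R j]
    (by
      simp only [Fin.sum_univ_three, Matrix.cons_val]
      omega)
  have hfin : (Set.range v ∪ ↑A).Finite := (Set.finite_range v).union A.finite_toSet
  obtain ⟨Q, hQO, hQgen⟩ := (MeasureTheory.Measure.dense_of_ae
    (hgen.ae_union_singleton hfin)).inter_open_nonempty O hO hOne
  obtain ⟨hQ, hcount⟩ := hOQ Q hQO
  have hQX : 0 < cross2 (p j) (p (j + 1)) Q := hQ 0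
  have hQY : 0 < cross2 (p (j + 1)) (p 0) Q := hQ 1
  have hQZ : 0 < cross2 (p 0) (p j) Q := hQ 2
  have hcount0 : (T.filter fun x => 0 < cross2 (p (j + 1)) Q x ∧ 0 < cross2 Q (p j) x).card =
      c J := hcount 0
  have hcount1 : (T.filter fun x => 0 < cross2 (p 0) Q x ∧ 0 < cross2 Q (p (j + 1)) x).card =
      (∑ k ∈ Finset.univ.filter (fun k : Fin n => J < k), c k) - L := hcount 1
  have hcount2 : (T.filter fun x => 0 < cross2 (p j) Q x ∧ 0 < cross2 Q (p 0) x).card =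
      C j - R j := hcount 2
  obtain ⟨hleft, hmid, hright⟩ :=
    card_filter_of_triangle hD hQX hQY hQZ A hAX hAY hAZ hAneg
  refine ⟨J, hj, by simp only [J]; omega, Q, ?_, ?_, ?_, ?_, hQgen⟩
  · rw [hv0, hvJ, hvJ1]
    exact (mem_interior_triangle_iff hD).2 ⟨hQZ, hQX, hQY⟩
  · rw [(hcyc.leftPath_isCCWCycle hj hjn hQZ hQX hQY).polyInteriorL_eq (by simp [J])]
    · have : (↑A : Set (ℝ × ℝ)) ∩ {x | ∀ i < j + 2, 0 < cross2 (IsCCWCycle.leftPath p j Q i)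
          (IsCCWCycle.leftPath p j Q (i + 1)) x} =
          ↑(A.filter fun x => 0 < cross2 (p j) Q x ∧ 0 < cross2 Q (p 0) x) := by
        ext x
        rw [Finset.coe_filter]
        exact and_congr_right fun hx => IsCCWCycle.forall_leftPath_iff hjn (hAedge x hx)
      rw [this, Set.ncard_coe_finset, hleft, hcount2]
      have hCj : ∑ k ∈ Finset.univ.filter (fun k : Fin n => k < J), c k = C j := rfl
      rw [hCj]
      change R j + (C j - R j) = C j
      omega
    · intro i hi
      rw [List.getElem_append]
      split_ifs with h
      · have hij : i < j + 1 := by simpa [J] using h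
        rw [List.getElem_ofFn, IsCCWCycle.leftPath_of_le Q (by omega), hpv i (by omega)]
        rfl
      · have hij : i = j + 1 := by
          simp [J] at h hi
          omega
        subst hij
        rw [IsCCWCycle.leftPath_succ]
        simp
  · have : (↑A : Set (ℝ × ℝ)) ∩ interior (convexHull ℝ ({v J, Q, v (J + 1)} : Set (ℝ × ℝ))) =
        ↑(A.filter fun x => 0 < cross2 (p (j + 1)) Q x ∧ 0 < cross2 Q (p j) x) := by
      ext x
      rw [Finset.coe_filter, hvJ, hvJ1, Set.pair_comm]
      refine and_congr_right fun hx => ?_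
      rw [mem_interior_triangle_iff hQX]
      exact ⟨fun h => h.2, fun h => ⟨hAX x hx, h⟩⟩
    rw [this, Set.ncard_coe_finset, hmid, hcount0]
  · rw [(hcyc.rightPath_isCCWCycle hj hjn hQZ hQX hQY).polyInteriorL_eq
      (by simp [J]; omega)]
    · have : (↑A : Set (ℝ × ℝ)) ∩ {x | ∀ i < n + 1 - j, 0 <
          cross2 (IsCCWCycle.rightPath p j Q i) (IsCCWCycle.rightPath p j Q (i + 1)) x} =
          ↑(A.filter fun x => 0 < cross2 (p 0) Q x ∧ 0 < cross2 Q (p (j + 1)) x) := by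
        ext x
        rw [Finset.coe_filter]
        exact and_congr_right fun hx => IsCCWCycle.forall_rightPath_iff hjn (hAedge x hx)
      rw [this, Set.ncard_coe_finset, hright, hcount1]
      omega
    · intro i hi
      rcases i with _ | _ | i
      · exact hv0
      · rfl
      · have hi' : j + 1 + i < n := by
          simp [J] at hi
          omega
        rw [IsCCWCycle.rightPath_add_two, hpv _ hi']
        simp [J]
end
end

section
/- Let P = P_1...P_n be a convex polygon and A a finite set of m interior points with the configuration in general+ position, and let c_1, ..., c_n be nonnegative integers summing to m. Then the interior of P can be partitioned into pairwise non-overlapping convex regions R_1, ..., R_n such that each R_i has the edge P_iP_{i+1} on its boundary, contains exactly c_i points of A in its interior, and has no point of A on its boundary. -/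
noncomputable section
open Set

open Set

/-- The affine functional on the plane with coefficients `w`. -/
def affEval (w : ℝ × ℝ × ℝ) (x : ℝ × ℝ) : ℝ := w.1 * x.1 + w.2.1 * x.2 + w.2.2

lemma continuous_affEval (w : ℝ × ℝ × ℝ) : Continuous (affEval w) := by
  unfold affEval; fun_prop

lemma affEval_combo (w : ℝ × ℝ × ℝ) (x y : ℝ × ℝ) {s t : ℝ} (h : s + t = 1) :
    affEval w (s • x + t • y) = s * affEval w x + t * affEval w y := by
  obtain rfl : t = 1 - s := by linarith
  simp [affEval]; ring

lemma convex_affEval_le (w : ℝ × ℝ × ℝ) : Convex ℝ {x | affEval w x ≤ 0} := by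
  intro x hx y hy s t hs ht hst
  simp only [mem_ofPred_eq] at hx hy ⊢
  rw [affEval_combo w x y hst]
  nlinarith [mul_nonneg hs (neg_nonneg.2 hx), mul_nonneg ht (neg_nonneg.2 hy)]

lemma convex_affEval_ge (w : ℝ × ℝ × ℝ) : Convex ℝ {x | 0 ≤ affEval w x} := by
  intro x hx y hy s t hs ht hst
  simp only [mem_ofPred_eq] at hx hy ⊢
  rw [affEval_combo w x y hst]
  nlinarith [mul_nonneg hs hx, mul_nonneg ht hy]

/-- A nonconstant affine functional that is nonnegative on a set is positive on its interior. -/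
lemma affEval_pos_of_mem_interior {w : ℝ × ℝ × ℝ} {K : Set (ℝ × ℝ)}
    (hK : ∀ x ∈ K, 0 ≤ affEval w x) {z : ℝ × ℝ} (hz : affEval w z ≠ 0)
    {z' : ℝ × ℝ} (hz' : affEval w z' = 0) {x : ℝ × ℝ} (hx : x ∈ interior K) :
    0 < affEval w x := by
  have hx0 : 0 ≤ affEval w x := hK x (interior_subset hx)
  have hw : 0 < w.1 ^ 2 + w.2.1 ^ 2 := by
    by_contra hcon
    have h1 : w.1 = 0 := by nlinarith [sq_nonneg w.1, sq_nonneg w.2.1]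
    have h2 : w.2.1 = 0 := by nlinarith [sq_nonneg w.1, sq_nonneg w.2.1]
    simp only [affEval, h1, h2] at hz hz'
    apply hz
    linarith
  have hcont : Continuous fun ε : ℝ => (x.1 - ε * w.1, x.2 - ε * w.2.1) := by fun_prop
  have hev : ∀ᶠ ε in nhds (0 : ℝ), (x.1 - ε * w.1, x.2 - ε * w.2.1) ∈ K := by
    refine hcont.continuousAt.eventually_mem ?_
    simpa using mem_interior_iff_mem_nhds.1 hx
  obtain ⟨ε, hε, hpos⟩ :=
    ((hev.filter_mono nhdsWithin_le_nhds).and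
      (self_mem_nhdsWithin : Ioi (0 : ℝ) ∈ nhdsWithin 0 (Ioi 0))).exists
  have h := hK _ hε
  have hpos' : 0 < ε * (w.1 ^ 2 + w.2.1 ^ 2) := mul_pos hpos hw
  simp only [affEval] at h ⊢
  nlinarith

lemma collinear_of_affEval_eq_zero {w : ℝ × ℝ × ℝ} {z : ℝ × ℝ} (hz : affEval w z ≠ 0)
    {a b p : ℝ × ℝ} (ha : affEval w a = 0) (hb : affEval w b = 0) (hp : affEval w p = 0) :
    Collinear ℝ ({a, b, p} : Set (ℝ × ℝ)) := by
  have hw : w.1 ^ 2 + w.2.1 ^ 2 ≠ 0 := by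
    intro hcon
    have h1 : w.1 = 0 := by nlinarith [sq_nonneg w.1, sq_nonneg w.2.1]
    have h2 : w.2.1 = 0 := by nlinarith [sq_nonneg w.1, sq_nonneg w.2.1]
    simp only [affEval, h1, h2] at hz ha
    apply hz
    linarith
  have key : ∀ x : ℝ × ℝ, affEval w x = 0 →
      ∃ r : ℝ, x = r • ((-w.2.1, w.1) : ℝ × ℝ) +ᵥ a := by
    intro x hx
    refine ⟨(-w.2.1 * (x.1 - a.1) + w.1 * (x.2 - a.2)) / (w.1 ^ 2 + w.2.1 ^ 2), ?_⟩
    simp only [affEval] at hx ha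
    ext
    · simp only [vadd_eq_add, Prod.fst_add, Prod.smul_fst, smul_eq_mul]
      field_simp
      linear_combination (w.1) * (hx - ha)
    · simp only [vadd_eq_add, Prod.snd_add, Prod.smul_snd, smul_eq_mul]
      field_simp
      linear_combination (w.2.1) * (hx - ha)
  rw [collinear_iff_of_mem (p₀ := a) (by simp)]
  refine ⟨(-w.2.1, w.1), ?_⟩
  rintro x (rfl | rfl | rfl)
  exacts [key _ ha, key _ hb, key _ hp]

/-- A line weakly separating two finite sets and passing through exactly one point of each
can be perturbed to a strictly separating one. -/
lemma exists_strict_sep {w : ℝ × ℝ × ℝ} {a b : ℝ × ℝ} (hab : a ≠ b)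
    (ha : affEval w a = 0) (hb : affEval w b = 0) (U V : Finset (ℝ × ℝ))
    (hU : ∀ x ∈ U, x ≠ a → affEval w x < 0) (hV : ∀ y ∈ V, y ≠ b → 0 < affEval w y) :
    ∃ g : ℝ × ℝ × ℝ, (∀ x ∈ U, affEval g x < 0) ∧ ∀ y ∈ V, 0 < affEval g y := by
  set u : ℝ × ℝ × ℝ := (b.1 - a.1, b.2 - a.2,
    -((b.1 - a.1) * (a.1 + b.1) + (b.2 - a.2) * (a.2 + b.2)) / 2) with hu
  have hD : 0 < (b.1 - a.1) ^ 2 + (b.2 - a.2) ^ 2 := by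
    by_contra hcon
    apply hab
    have h1 : b.1 - a.1 = 0 := by nlinarith [sq_nonneg (b.1 - a.1), sq_nonneg (b.2 - a.2)]
    have h2 : b.2 - a.2 = 0 := by nlinarith [sq_nonneg (b.1 - a.1), sq_nonneg (b.2 - a.2)]
    ext <;> linarith
  have hua : affEval u a < 0 := by simp only [affEval, hu]; nlinarith
  have hub : 0 < affEval u b := by simp only [affEval, hu]; nlinarith
  have hadd : ∀ (ε : ℝ) (x : ℝ × ℝ),
      affEval (w + ε • u) x = affEval w x + ε * affEval u x := by
    intro ε x; simp [affEval]; ring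
  have hcont : ∀ x : ℝ × ℝ, Continuous fun ε : ℝ => affEval w x + ε * affEval u x := by
    intro x; fun_prop
  have hpos : ∀ᶠ ε in nhdsWithin (0 : ℝ) (Ioi 0), 0 < ε := self_mem_nhdsWithin
  have hUev : ∀ᶠ ε in nhdsWithin (0 : ℝ) (Ioi 0), ∀ x ∈ U, affEval (w + ε • u) x < 0 := by
    rw [Filter.eventually_all_finset]
    intro x hx
    by_cases hxa : x = a
    · filter_upwards [hpos] with ε hε
      rw [hadd, hxa, ha]; nlinarith
    · have := ((hcont x).tendsto 0).eventually_lt_const (u := 0)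
        (by simpa using hU x hx hxa)
      filter_upwards [this.filter_mono nhdsWithin_le_nhds] with ε hε
      rwa [hadd]
  have hVev : ∀ᶠ ε in nhdsWithin (0 : ℝ) (Ioi 0), ∀ y ∈ V, 0 < affEval (w + ε • u) y := by
    rw [Filter.eventually_all_finset]
    intro y hy
    by_cases hyb : y = b
    · filter_upwards [hpos] with ε hε
      rw [hadd, hyb, hb]; nlinarith [mul_pos hε hub]
    · have := ((hcont y).tendsto 0).eventually_const_lt (u := 0)
        (by simpa using hV y hy hyb)
      filter_upwards [this.filter_mono nhdsWithin_le_nhds] with ε hε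
      rwa [hadd]
  obtain ⟨ε, h1, h2⟩ := (hUev.and hVev).exists
  exact ⟨_, h1, h2⟩

/-- If no exchange of a point of `X` with a point of `Y` decreases the product of the distances
to two edges `p p'` and `q q'`, then a line separates `X` and the first edge from `Y` and the
second edge, strictly as far as `X` and `Y` are concerned. -/
lemma exists_sep_of_exchange {S : Set (ℝ × ℝ)} (hS : GenPos S) {φ ψ : ℝ × ℝ × ℝ}
    {X Y : Finset (ℝ × ℝ)} {p p' q q' : ℝ × ℝ} (hX : ↑X ⊆ S) (hY : ↑Y ⊆ S)
    (hXY : Disjoint X Y)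
    (hp : p ∈ S) (hp' : p' ∈ S) (hq : q ∈ S) (hq' : q' ∈ S)
    (hφ : ∀ x ∈ X ∪ Y, 0 < affEval φ x) (hψ : ∀ x ∈ X ∪ Y, 0 < affEval ψ x)
    (hφp : affEval φ p = 0) (hφp' : affEval φ p' = 0)
    (hψq : affEval ψ q = 0) (hψq' : affEval ψ q' = 0)
    (hψp : 0 ≤ affEval ψ p) (hψp' : 0 ≤ affEval ψ p')
    (hφq : 0 ≤ affEval φ q) (hφq' : 0 ≤ affEval φ q')
    (hne : 0 < affEval φ q ∨ 0 < affEval φ q')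
    (hex : ∀ x ∈ X, ∀ y ∈ Y, affEval φ x * affEval ψ y ≤ affEval ψ x * affEval φ y) :
    ∃ g : ℝ × ℝ × ℝ, (∀ x ∈ X, affEval g x < 0) ∧ (∀ y ∈ Y, 0 < affEval g y) ∧
      affEval g p ≤ 0 ∧ affEval g p' ≤ 0 ∧ 0 ≤ affEval g q ∧ 0 ≤ affEval g q' ∧
      ∃ z, affEval g z ≠ 0 := by
  have hsub : ∀ (t : ℝ) (x : ℝ × ℝ),
      affEval (φ - t • ψ) x = affEval φ x - t * affEval ψ x := by
    intro t x; simp [affEval]; ring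
  have hnz : ∀ t : ℝ, ∃ z, affEval (φ - t • ψ) z ≠ 0 := by
    intro t
    rcases hne with h | h
    · exact ⟨q, by rw [hsub, hψq]; simpa using h.ne'⟩
    · exact ⟨q', by rw [hsub, hψq']; simpa using h.ne'⟩
  by_cases htie : ∃ a ∈ X, ∃ b ∈ Y, affEval φ a * affEval ψ b = affEval ψ a * affEval φ b
  · obtain ⟨a, ha, b, hb, hab⟩ := htie
    have hφa := hφ a (Finset.mem_union_left _ ha)
    have hψa := hψ a (Finset.mem_union_left _ ha)
    have hφb := hφ b (Finset.mem_union_right _ hb)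
    have hψb := hψ b (Finset.mem_union_right _ hb)
    set t := affEval φ a / affEval ψ a with ht
    have ht0 : 0 < t := div_pos hφa hψa
    have hta : affEval φ a = t * affEval ψ a := by rw [ht]; field_simp
    have htb : affEval φ b = t * affEval ψ b := by
      rw [ht]; field_simp; linarith
    have hne_ab : a ≠ b := Finset.disjoint_left.1 hXY |> fun h e => h ha (e ▸ hb)
    have hfa : affEval (φ - t • ψ) a = 0 := by rw [hsub]; linarith
    have hfb : affEval (φ - t • ψ) b = 0 := by rw [hsub]; linarith
    obtain ⟨z, hz⟩ := hnz t
    have hzero : ∀ x ∈ S, x ≠ a → x ≠ b → affEval (φ - t • ψ) x ≠ 0 := by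
      intro x hx hxa hxb h0
      exact hS a (hX ha) b (hY hb) x hx hne_ab hxa.symm hxb.symm
        (collinear_of_affEval_eq_zero hz hfa hfb h0)
    have hne_of : ∀ {θ : ℝ × ℝ × ℝ} {x y : ℝ × ℝ}, affEval θ x = 0 → 0 < affEval θ y → x ≠ y := by
      rintro θ x y h0 h1 rfl; exact h1.ne' h0
    obtain ⟨g, hgU, hgV⟩ := exists_strict_sep (w := φ - t • ψ) hne_ab hfa hfb
      (X ∪ {p, p'}) (Y ∪ {q, q'})
      (by
        intro x hx hxa
        simp only [Finset.mem_union, Finset.mem_insert, Finset.mem_singleton] at hx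
        rcases hx with hx | rfl | rfl
        · refine lt_of_le_of_ne ?_ (hzero x (hX hx) hxa
            fun e => Finset.disjoint_left.1 hXY hx (e ▸ hb))
          rw [hsub]
          have := hex x hx b hb
          rw [htb] at this
          nlinarith
        · refine lt_of_le_of_ne ?_ (hzero x hp (hne_of hφp hφa) (hne_of hφp hφb))
          rw [hsub, hφp]; nlinarith
        · refine lt_of_le_of_ne ?_ (hzero x hp' (hne_of hφp' hφa) (hne_of hφp' hφb))
          rw [hsub, hφp']; nlinarith)
      (by
        intro y hy hyb
        simp only [Finset.mem_union, Finset.mem_insert, Finset.mem_singleton] at hy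
        rcases hy with hy | rfl | rfl
        · refine lt_of_le_of_ne ?_ (hzero y (hY hy)
            (fun e => Finset.disjoint_left.1 hXY ha (e ▸ hy)) hyb).symm
          rw [hsub]
          have := hex a ha y hy
          rw [hta] at this
          nlinarith
        · refine lt_of_le_of_ne ?_ (hzero y hq (hne_of hψq hψa) (hne_of hψq hψb)).symm
          rw [hsub, hψq]; linarith
        · refine lt_of_le_of_ne ?_ (hzero y hq' (hne_of hψq' hψa) (hne_of hψq' hψb)).symm
          rw [hsub, hψq']; linarith)
    exact ⟨g, fun x hx => hgU x (by simp [hx]), fun y hy => hgV y (by simp [hy]),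
      (hgU p (by simp)).le, (hgU p' (by simp)).le, (hgV q (by simp)).le, (hgV q' (by simp)).le,
      a, (hgU a (by simp [ha])).ne⟩
  · push Not at htie
    obtain ⟨t, htX, htY⟩ := Order.exists_between_finsets
      (insert 0 (X.image fun x => affEval φ x / affEval ψ x))
      (Y.image fun x => affEval φ x / affEval ψ x) (by
        intro r hr s hs
        obtain ⟨y, hy, rfl⟩ := Finset.mem_image.1 hs
        have hφy := hφ y (Finset.mem_union_right _ hy)
        have hψy := hψ y (Finset.mem_union_right _ hy)
        rcases Finset.mem_insert.1 hr with rfl | hr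
        · exact div_pos hφy hψy
        · obtain ⟨x, hx, rfl⟩ := Finset.mem_image.1 hr
          rw [div_lt_div_iff₀ (hψ x (Finset.mem_union_left _ hx)) hψy]
          have := lt_of_le_of_ne (hex x hx y hy) (htie x hx y hy)
          linarith)
    have ht0 : 0 < t := htX 0 (Finset.mem_insert_self _ _)
    refine ⟨φ - t • ψ, fun x hx => ?_, fun y hy => ?_, ?_, ?_, ?_, ?_, hnz t⟩
    · have := htX _ (Finset.mem_insert_of_mem (Finset.mem_image_of_mem _ hx))
      rw [div_lt_iff₀ (hψ x (Finset.mem_union_left _ hx))] at this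
      rw [hsub]; linarith
    · have := htY _ (Finset.mem_image_of_mem _ hy)
      rw [lt_div_iff₀ (hψ y (Finset.mem_union_right _ hy))] at this
      rw [hsub]; linarith
    · rw [hsub, hφp]; nlinarith
    · rw [hsub, hφp']; nlinarith
    · rw [hsub, hψq]; linarith
    · rw [hsub, hψq']; linarith

/-- Among the maps with prescribed fibre sizes there is one for which no exchange of two values
decreases the product of the weights. -/
lemma exists_exchange_optimal {α ι : Type*} [Fintype α] [DecidableEq α] [Fintype ι]
    [DecidableEq ι] (c : ι → ℕ) (hc : ∑ i, c i = Fintype.card α) (d : ι → α → ℝ)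
    (hd : ∀ i a, 0 < d i a) :
    ∃ σ : α → ι, (∀ i, (Finset.univ.filter fun a => σ a = i).card = c i) ∧
      ∀ a b, σ a ≠ σ b → d (σ a) a * d (σ b) b ≤ d (σ b) a * d (σ a) b := by
  let T : Finset (α → ι) :=
    Finset.univ.filter fun σ => ∀ i, (Finset.univ.filter fun a => σ a = i).card = c i
  have hT : T.Nonempty := by
    have e : α ≃ Σ i, Fin (c i) := Fintype.equivOfCardEq (by simp [hc])
    refine ⟨fun a => (e a).1, Finset.mem_filter.2 ⟨Finset.mem_univ _, fun i => ?_⟩⟩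
    have h : (Finset.univ.filter fun a => (e a).1 = i).card =
        (Finset.univ.filter fun s : Σ i, Fin (c i) => s.1 = i).card :=
      Finset.card_bij (fun a _ => e a) (by simp) (by simp) (fun s hs =>
        ⟨e.symm s, by simpa using hs, by simp⟩)
    rw [h]
    have h2 : (Finset.univ.filter fun s : Σ i, Fin (c i) => s.1 = i) =
        Finset.univ.map ⟨fun k : Fin (c i) => (⟨i, k⟩ : Σ i, Fin (c i)),
          fun _ _ h => by simpa using h⟩ := by
      ext ⟨j, k⟩
      simp only [Finset.mem_filter, Finset.mem_univ, true_and, Finset.mem_map]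
      constructor
      · rintro rfl; exact ⟨k, rfl⟩
      · rintro ⟨k', hk'⟩; exact (congrArg Sigma.fst hk').symm
    rw [h2]; simp
  obtain ⟨σ, hσ, hmin⟩ := T.exists_min_image (fun σ => ∏ a, d (σ a) a) hT
  have hσ' := (Finset.mem_filter.1 hσ).2
  refine ⟨σ, hσ', fun a b hab => ?_⟩
  have hne : b ≠ a := fun e => hab (e ▸ rfl)
  have hswap : (fun x => σ (Equiv.swap a b x)) ∈ T := by
    refine Finset.mem_filter.2 ⟨Finset.mem_univ _, fun i => ?_⟩
    rw [← hσ' i]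
    exact Finset.card_bij (fun x _ => Equiv.swap a b x) (by simp) (by simp) (fun s hs =>
      ⟨Equiv.swap a b s, by simpa using hs, by simp⟩)
  have hle := hmin _ hswap
  have hsplit : ∀ f : α → ℝ, ∏ x, f x = f a * (f b * ∏ x ∈ (Finset.univ.erase a).erase b, f x) := by
    intro f
    rw [Finset.mul_prod_erase _ _ (by simp [hne]), Finset.mul_prod_erase _ _ (by simp)]
  rw [hsplit, hsplit (fun x => d (σ (Equiv.swap a b x)) x)] at hle
  have hrest : ∏ x ∈ (Finset.univ.erase a).erase b, d (σ (Equiv.swap a b x)) x =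
      ∏ x ∈ (Finset.univ.erase a).erase b, d (σ x) x := by
    refine Finset.prod_congr rfl fun x hx => ?_
    simp only [Finset.mem_erase] at hx
    rw [Equiv.swap_apply_of_ne_of_ne hx.2.1 hx.1]
  rw [hrest, Equiv.swap_apply_left, Equiv.swap_apply_right, ← mul_assoc, ← mul_assoc] at hle
  exact le_of_mul_le_mul_right hle (Finset.prod_pos fun x _ => hd _ _)

/-- The coefficients of the affine functional `cross2 a b`. -/
def edgeFunctional (a b : ℝ × ℝ) : ℝ × ℝ × ℝ :=
  (-(b.2 - a.2), b.1 - a.1, (b.2 - a.2) * a.1 - (b.1 - a.1) * a.2)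

lemma affEval_edgeFunctional (a b x : ℝ × ℝ) :
    affEval (edgeFunctional a b) x = cross2 a b x := by
  simp only [affEval, edgeFunctional, cross2]; ring

/-- subdivision of a convex polygon into pairwise non-overlapping convex
regions `R i`, one along each edge `v i v (i+1)`, containing prescribed numbers `c i`
of the interior points `A` strictly inside and none on their boundaries. -/
theorem stmt11 {n : ℕ} [NeZero n] (v : Fin n → ℝ × ℝ) (hconv : IsConvexPolygonCCW v)
    (A : Finset (ℝ × ℝ)) (m : ℕ) (hm : A.card = m)
    (hA : ↑A ⊆ interior (convexHull ℝ (Set.range v)))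
    (hgen : GenPlusPos (Set.range v ∪ ↑A))
    (c : Fin n → ℕ) (hsum : ∑ i, c i = m) :
    ∃ R : Fin n → Set (ℝ × ℝ),
      (∀ i, Convex ℝ (R i)) ∧
      (∀ i, IsClosed (R i)) ∧
      (∀ i, R i ⊆ convexHull ℝ (Set.range v)) ∧
      (∀ i j, i ≠ j → interior (R i) ∩ interior (R j) = ∅) ∧
      (∀ i, segment ℝ (v i) (v (i + 1)) ⊆ R i ∩ frontier (R i)) ∧
      (∀ i, ((↑A : Set (ℝ × ℝ)) ∩ interior (R i)).ncard = c i) ∧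
      (∀ i, (↑A : Set (ℝ × ℝ)) ∩ frontier (R i) = ∅) := by
  classical
  obtain ⟨hn, hpos⟩ := hconv
  set S : Set (ℝ × ℝ) := Set.range v ∪ ↑A
  set P := convexHull ℝ (Set.range v) with hP
  let D : Fin n → ℝ × ℝ × ℝ := fun i => edgeFunctional (v i) (v (i + 1))
  have hvS : ∀ i, v i ∈ S := fun i => Or.inl ⟨i, rfl⟩
  have hDpos : ∀ i j, j ≠ i → j ≠ i + 1 → 0 < affEval (D i) (v j) := fun i j h1 h2 => by
    rw [affEval_edgeFunctional]; exact hpos i j h1 h2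
  have hD0 : ∀ i, affEval (D i) (v i) = 0 := fun i => by
    rw [affEval_edgeFunctional, cross2]; ring
  have hD1 : ∀ i, affEval (D i) (v (i + 1)) = 0 := fun i => by
    rw [affEval_edgeFunctional, cross2]; ring
  have hDnn : ∀ i j, 0 ≤ affEval (D i) (v j) := fun i j => by
    by_cases h1 : j = i
    · rw [h1, hD0]
    by_cases h2 : j = i + 1
    · rw [h2, hD1]
    exact (hDpos i j h1 h2).le
  have hDP : ∀ i, ∀ x ∈ P, 0 ≤ affEval (D i) x := fun i =>
    convexHull_min (by rintro _ ⟨j, rfl⟩; exact hDnn i j) (convex_affEval_ge (D i))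
  have hone : ∀ i : Fin n, i + 1 + 1 ≠ i := by
    intro i h
    obtain ⟨k, rfl⟩ : ∃ k, n = k + 3 := ⟨n - 3, by omega⟩
    have h2 : (1 + 1 : Fin (k + 3)) = 0 := by
      rw [add_assoc] at h; simpa using h
    have := congrArg Fin.val h2
    simp [Fin.val_add, Nat.mod_eq_of_lt] at this
  have hone' : (1 : Fin n) ≠ 0 := by
    intro h
    exact hone 0 (by rw [h]; simp)
  have hDne : ∀ i, affEval (D i) (v (i + 1 + 1)) ≠ 0 := fun i =>
    (hDpos i _ (hone i) (by simpa using hone')).ne'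
  have hDint : ∀ i, ∀ x ∈ interior P, 0 < affEval (D i) x := fun i x hx =>
    affEval_pos_of_mem_interior (hDP i) (hDne i) (hD0 i) hx
  obtain ⟨σ, hcard, hopt⟩ := exists_exchange_optimal (α := A) c (by simp [hsum, hm])
    (fun i a => affEval (D i) a) (fun i a => hDint i _ (hA a.2))
  let B : Fin n → Finset (ℝ × ℝ) := fun i =>
    (Finset.univ.filter fun a : A => σ a = i).map (Function.Embedding.subtype _)
  have hB : ∀ i x, x ∈ B i ↔ ∃ h : x ∈ A, σ ⟨x, h⟩ = i := fun i x => by simp [B]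
  have hBA : ∀ i x, x ∈ B i → x ∈ A := fun i x hx => ((hB i x).1 hx).1
  have hsep : ∀ i j, i ≠ j → ∃ g : ℝ × ℝ × ℝ,
      (∀ x ∈ B i, affEval g x < 0) ∧ (∀ y ∈ B j, 0 < affEval g y) ∧
      affEval g (v i) ≤ 0 ∧ affEval g (v (i + 1)) ≤ 0 ∧
      0 ≤ affEval g (v j) ∧ 0 ≤ affEval g (v (j + 1)) ∧ ∃ z, affEval g z ≠ 0 := by
    intro i j hij
    have hpos' : ∀ k, ∀ x ∈ B i ∪ B j, 0 < affEval (D k) x := by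
      intro k x hx
      refine hDint k x (hA ?_)
      rcases Finset.mem_union.1 hx with h | h
      exacts [hBA _ _ h, hBA _ _ h]
    refine exists_sep_of_exchange hgen.1 (fun x hx => Or.inr (hBA i x hx))
      (fun x hx => Or.inr (hBA j x hx)) ?_ (hvS _) (hvS _) (hvS _) (hvS _)
      (hpos' i) (hpos' j) (hD0 i) (hD1 i) (hD0 j) (hD1 j) (hDnn _ _) (hDnn _ _) (hDnn _ _)
      (hDnn _ _) ?_ ?_
    · refine Finset.disjoint_left.2 fun x hx hy => hij ?_
      obtain ⟨h, rfl⟩ := (hB i x).1 hx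
      obtain ⟨h', rfl⟩ := (hB j x).1 hy
      rfl
    · by_cases hj : j = i + 1
      · right
        subst hj
        exact hDpos i _ (hone i) (by simpa using hone')
      · exact Or.inl (hDpos i j hij.symm hj)
    · intro x hx y hy
      obtain ⟨h, rfl⟩ := (hB i x).1 hx
      obtain ⟨h', rfl⟩ := (hB j y).1 hy
      exact hopt _ _ hij
  choose! g hgX hgY hgp hgp' hgq hgq' hgne using hsep
  let R : Fin n → Set (ℝ × ℝ) := fun i => P ∩ ⋂ j, ⋂ (_ : i ≠ j),
    ({x | affEval (g i j) x ≤ 0} ∩ {x | 0 ≤ affEval (g j i) x})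
  have hRP : ∀ i, R i ⊆ P := fun i => inter_subset_left
  have hRmem : ∀ i j x, i ≠ j → x ∈ R i → affEval (g i j) x ≤ 0 ∧ 0 ≤ affEval (g j i) x := by
    intro i j x hij hx
    have := hx.2
    simp only [mem_iInter] at this
    exact this j hij
  have hRconv : ∀ i, Convex ℝ (R i) := fun i =>
    (convex_convexHull ℝ _).inter (convex_iInter fun j => convex_iInter fun _ =>
      (convex_affEval_le _).inter (convex_affEval_ge _))
  have hRclosed : ∀ i, IsClosed (R i) := fun i =>
    (Set.finite_range v).isClosed_convexHull ℝ |>.inter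
      (isClosed_iInter fun j => isClosed_iInter fun _ =>
        (isClosed_le (continuous_affEval _) continuous_const).inter
          (isClosed_le continuous_const (continuous_affEval _)))
  have hBint : ∀ i, ∀ x ∈ B i, x ∈ interior (R i) := by
    intro i x hx
    let O : Set (ℝ × ℝ) := interior P ∩ ⋂ j, ⋂ (_ : i ≠ j),
      ({x | affEval (g i j) x < 0} ∩ {x | 0 < affEval (g j i) x})
    have hO : IsOpen O := isOpen_interior.inter
      (isOpen_iInter_of_finite fun j => isOpen_iInter_of_finite fun _ =>
        (isOpen_lt (continuous_affEval _) continuous_const).inter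
          (isOpen_lt continuous_const (continuous_affEval _)))
    refine interior_maximal (s := R i) (t := O) ?_ hO ?_
    · refine inter_subset_inter interior_subset (iInter_mono fun j => iInter_mono fun _ =>
        inter_subset_inter ?_ ?_)
      · exact fun y (hy : affEval (g i j) y < 0) => hy.le
      · exact fun y (hy : 0 < affEval (g j i) y) => hy.le
    · refine ⟨hA (hBA i x hx), ?_⟩
      simp only [mem_iInter]
      exact fun j hij => ⟨hgX i j hij x hx, hgY j i hij.symm x hx⟩
  have hBunique : ∀ i, ∀ x ∈ A, x ∈ R i → x ∈ B i := by
    intro i x hxA hxR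
    by_contra hcon
    have hx : x ∈ B (σ ⟨x, hxA⟩) := (hB _ _).2 ⟨hxA, rfl⟩
    have hij : i ≠ σ ⟨x, hxA⟩ := fun e => hcon (e ▸ hx)
    exact absurd (hgY i _ hij x hx) (not_lt.2 (hRmem i _ x hij hxR).1)
  refine ⟨R, hRconv, hRclosed, hRP, ?_, ?_, ?_, ?_⟩
  · intro i j hij
    refine eq_empty_of_forall_notMem fun x hx => ?_
    rw [← interior_inter] at hx
    have hxR := interior_subset hx
    have h0 : affEval (g i j) x = 0 :=
      le_antisymm (hRmem i j x hij hxR.1).1 (hRmem j i x hij.symm hxR.2).2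
    obtain ⟨z, hz⟩ := hgne i j hij
    exact (affEval_pos_of_mem_interior
      (fun y hy => (hRmem j i y hij.symm hy.2).2) hz h0 hx).ne' h0
  · intro i
    have hseg : segment ℝ (v i) (v (i + 1)) ⊆ R i := by
      refine (hRconv i).segment_subset ?_ ?_
      · refine ⟨subset_convexHull ℝ _ ⟨i, rfl⟩, ?_⟩
        simp only [mem_iInter]
        exact fun j hij => ⟨hgp i j hij, hgq j i hij.symm⟩
      · refine ⟨subset_convexHull ℝ _ ⟨i + 1, rfl⟩, ?_⟩
        simp only [mem_iInter]
        exact fun j hij => ⟨hgp' i j hij, hgq' j i hij.symm⟩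
    refine fun x hx => ⟨hseg hx, subset_closure (hseg hx), fun hint => ?_⟩
    have hlt := hDint i x (interior_mono (hRP i) hint)
    obtain ⟨s, t, -, -, hst, rfl⟩ := hx
    rw [affEval_combo _ _ _ hst, hD0, hD1] at hlt
    simp at hlt
  · intro i
    have : (↑A : Set (ℝ × ℝ)) ∩ interior (R i) = ↑(B i) := by
      ext x
      exact ⟨fun hx => hBunique i x hx.1 (interior_subset hx.2),
        fun hx => ⟨hBA i x hx, hBint i x hx⟩⟩
    rw [this, Set.ncard_coe_finset, Finset.card_map, hcard]
  · intro i
    ext x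
    simp only [mem_inter_iff, mem_empty_iff_false, iff_false, not_and]
    intro hxA hxf
    exact hxf.2 (hBint i x (hBunique i x hxA ((hRclosed i).frontier_subset hxf)))
end
end
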